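/- Let $M$ be an $n\times n$ random matrix whose entries are i.i.d., each taking the value $0$ with probability $1/2$ and each of the values $1$ and $-1$ with probability $1/4$. Fix $1\le j_{1}<j_{2}\le n$ and let $d_{1},d_{2}$ be the determinants of the $(n-1)\times(n-1)$ minors of $M$ obtained by deleting the first row and the $j_{1}$-th (respectively $j_{2}$-th) column. Let $\tau_{1},\tau_{2}\in\{1,-1,2,-2\}$ and let $Y$ denote the number of positive divisors of $\tau_{1}d_{1}+\tau_{2}d_{2}$ when this quantity is nonzero, with the convention $Y=1$ when it is zero. Then there exists an absolute constant $C>0$ such that for all $n\ge 2$, $\mathbb{E}[\log Y]\le C(\log n)^{2}$. -/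

import Mathlib

open MeasureTheory

/-- The law of a single entry: `0` with probability `1/2`, `1` and `-1` with
probability `1/4` each. -/
noncomputable def entryMeasure : Measure ℤ :=
  (1/2 : ENNReal) • Measure.dirac 0 + (1/4 : ENNReal) • Measure.dirac 1 +
    (1/4 : ENNReal) • Measure.dirac (-1)

instance : IsProbabilityMeasure entryMeasure := by
  constructor
  simp only [entryMeasure, Measure.add_apply, Measure.smul_apply, measure_univ, smul_eq_mul,
    mul_one, one_div]
  have h4 : (4⁻¹ + 4⁻¹ : ENNReal) = 2⁻¹ := by
    rw [← two_mul, show (4 : ENNReal) = 2 * 2 by norm_num,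
      ENNReal.mul_inv (by norm_num) (by norm_num), ← mul_assoc,
      ENNReal.mul_inv_cancel (by norm_num) (by norm_num), one_mul]
  rw [add_assoc, h4, ENNReal.inv_two_add_inv_two]

/-- The joint law of `n` i.i.d. entries. -/
noncomputable def vecMeasure (n : ℕ) : Measure (Fin n → ℤ) :=
  Measure.pi fun _ => entryMeasure

instance (n : ℕ) : IsProbabilityMeasure (vecMeasure n) := by
  unfold vecMeasure; infer_instance

/-- The law of an `n × n` random matrix (given as a function of its rows) with
i.i.d. entries distributed according to `entryMeasure`. -/
noncomputable def matMeasure (n : ℕ) : Measure (Fin n → Fin n → ℤ) :=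
  Measure.pi fun _ => vecMeasure n

instance (n : ℕ) : IsProbabilityMeasure (matMeasure n) := by
  unfold matMeasure; infer_instance

/-- The inclusion `Fin (n-1) → Fin n` skipping index `0` (deleting the first
row). -/
def delFirstRow (n : ℕ) : Fin (n - 1) → Fin n :=
  fun i => ⟨(i : ℕ) + 1, by have := i.isLt; omega⟩

/-- The inclusion `Fin (n-1) → Fin n` skipping index `j` (deleting the `j`-th
column). -/
def skipCol (n : ℕ) (j : Fin n) : Fin (n - 1) → Fin n :=
  fun i => if (i : ℕ) < (j : ℕ) then ⟨(i : ℕ), by have := i.isLt; omega⟩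
    else ⟨(i : ℕ) + 1, by have := i.isLt; omega⟩

/-- The determinant of the `(n-1) × (n-1)` first-row minor of `M` obtained by
deleting the first row and the `j`-th column. -/
def minorDet {n : ℕ} (M : Fin n → Fin n → ℤ) (j : Fin n) : ℤ :=
  ((Matrix.of M).submatrix (delFirstRow n) (skipCol n j)).det

/-- The mass that the weight `ω` gives to the set `S`. -/
noncomputable def mass {α : Type*} [Fintype α] (ω : α → ℝ) (S : Set α) : ℝ :=
  ∑ x, S.indicator ω x

/-- A probability weight on a finite type. -/
structure IsWeight {α : Type*} [Fintype α] (ω : α → ℝ) : Prop where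
  nonneg : ∀ x, 0 ≤ ω x
  sum_eq_one : ∑ x, ω x = 1

/-- The product weight on families of independent points. -/
def piWeight {α : Type*} (ι : Type*) [Fintype ι] (ω : α → ℝ) (x : ι → α) : ℝ :=
  ∏ i, ω (x i)

section Mass

variable {α β ι : Type*} [Fintype α] [Fintype ι] {ω : α → ℝ}

lemma mass_mono (hω : IsWeight ω) {S T : Set α} (h : S ⊆ T) : mass ω S ≤ mass ω T :=
  Finset.sum_le_sum fun x _ => Set.indicator_le_indicator_of_subset h hω.nonneg x

lemma mass_nonneg (hω : IsWeight ω) (S : Set α) : 0 ≤ mass ω S :=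
  Finset.sum_nonneg fun x _ => Set.indicator_nonneg (fun y _ => hω.nonneg y) x

lemma mass_univ (hω : IsWeight ω) : mass ω Set.univ = 1 := by
  simp [mass, hω.sum_eq_one]

lemma mass_le_one (hω : IsWeight ω) (S : Set α) : mass ω S ≤ 1 :=
  (mass_mono hω (Set.subset_univ S)).trans_eq (mass_univ hω)

lemma mass_empty : mass ω ∅ = 0 := by simp [mass]

lemma mass_union_le (hω : IsWeight ω) (S T : Set α) :
    mass ω (S ∪ T) ≤ mass ω S + mass ω T := by
  rw [mass, mass, mass, ← Finset.sum_add_distrib]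
  refine Finset.sum_le_sum fun x _ => ?_
  have := hω.nonneg x
  by_cases h1 : x ∈ S <;> by_cases h2 : x ∈ T <;> simp [h1, h2, this]

lemma mass_exists_le (hω : IsWeight ω) (s : Finset β) (P : β → α → Prop) :
    mass ω {x | ∃ b ∈ s, P b x} ≤ ∑ b ∈ s, mass ω {x | P b x} := by
  classical
  unfold mass
  rw [Finset.sum_comm]
  refine Finset.sum_le_sum fun x _ => ?_
  have h0 : ∀ b ∈ s, 0 ≤ Set.indicator {x | P b x} ω x := fun b _ =>
    Set.indicator_nonneg (fun y _ => hω.nonneg y) x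
  by_cases h : ∃ b ∈ s, P b x
  · obtain ⟨b, hb, hP⟩ := h
    rw [Set.indicator_of_mem (show x ∈ {x | ∃ b ∈ s, P b x} from ⟨b, hb, hP⟩)]
    refine le_trans ?_ (Finset.single_le_sum h0 hb)
    rw [Set.indicator_of_mem (show x ∈ {x | P b x} from hP)]
  · rw [Set.indicator_of_notMem (show x ∉ {x | ∃ b ∈ s, P b x} from h)]
    exact Finset.sum_nonneg h0

lemma sum_mass_fiber_le (hω : IsWeight ω) (s : Finset β) (g : α → β) :
    ∑ b ∈ s, mass ω {x | g x = b} ≤ 1 := by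
  classical
  unfold mass
  rw [Finset.sum_comm, ← hω.sum_eq_one]
  refine Finset.sum_le_sum fun x _ => ?_
  have : ∀ b, Set.indicator {x | g x = b} ω x = if g x = b then ω x else 0 := fun b => by
    simp [Set.indicator_apply]
  simp_rw [this]
  rw [Finset.sum_ite_eq]
  split_ifs
  · exact le_rfl
  · exact hω.nonneg x

lemma mass_comp_equiv [Fintype β] (e : β ≃ α) (S : Set α) :
    mass (fun b => ω (e b)) (e ⁻¹' S) = mass ω S := by
  unfold mass
  rw [← e.sum_comp]
  rfl

lemma IsWeight.piWeight [DecidableEq ι] (hω : IsWeight ω) : IsWeight (piWeight ι ω) where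
  nonneg x := Finset.prod_nonneg fun i _ => hω.nonneg _
  sum_eq_one := by
    have := Finset.prod_univ_sum (fun _ : ι => (Finset.univ : Finset α)) (fun _ a => ω a)
    simp only [hω.sum_eq_one, Finset.prod_const_one, Fintype.piFinset_univ] at this
    exact this.symm

lemma mass_prod_eq [Fintype β] (ω : α → ℝ) (ω' : β → ℝ) (S : Set (α × β)) :
    mass (fun z : α × β => ω z.1 * ω' z.2) S = ∑ a, ω a * mass ω' {b | (a, b) ∈ S} := by
  unfold mass
  rw [Fintype.sum_prod_type]
  refine Finset.sum_congr rfl fun a _ => ?_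
  rw [Finset.mul_sum]
  refine Finset.sum_congr rfl fun b _ => ?_
  by_cases h : (a, b) ∈ S
  · rw [Set.indicator_of_mem h, Set.indicator_of_mem (show b ∈ {b | (a, b) ∈ S} from h)]
  · rw [Set.indicator_of_notMem h, Set.indicator_of_notMem (show b ∉ {b | (a, b) ∈ S} from h),
      mul_zero]

lemma mass_prod_swap [Fintype β] (ω : α → ℝ) (ω' : β → ℝ) (S : Set (α × β)) :
    ∑ a, ω a * mass ω' {b | (a, b) ∈ S} = ∑ b, ω' b * mass ω {a | (a, b) ∈ S} := by
  rw [← mass_prod_eq]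
  refine Eq.trans ?_ (mass_prod_eq ω' ω {z | (z.2, z.1) ∈ S})
  rw [← mass_comp_equiv (Equiv.prodComm β α)]
  congr 1
  funext z
  simp [mul_comm]

lemma mass_piWeight_cons (m : ℕ) (S : Set (Fin (m + 1) → α)) :
    mass (piWeight (Fin (m + 1)) ω) S =
      ∑ a, ω a * mass (piWeight (Fin m) ω) {x | Fin.cons (α := fun _ => α) a x ∈ S} := by
  refine Eq.trans ?_ (mass_prod_eq ω (piWeight (Fin m) ω)
    {z | Fin.cons (α := fun _ => α) z.1 z.2 ∈ S})
  rw [← mass_comp_equiv (Fin.consEquiv fun _ : Fin (m + 1) => α)]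
  congr 1
  funext z
  simp [piWeight, Fin.consEquiv, Fin.prod_univ_succ]

lemma mass_piWeight_snoc (m : ℕ) (S : Set (Fin (m + 1) → α)) :
    mass (piWeight (Fin (m + 1)) ω) S =
      ∑ x, piWeight (Fin m) ω x * mass ω {a | Fin.snoc (α := fun _ => α) x a ∈ S} := by
  refine Eq.trans ?_ ((mass_prod_eq ω (piWeight (Fin m) ω)
    {z | Fin.snoc (α := fun _ => α) z.2 z.1 ∈ S}).trans
    (mass_prod_swap (piWeight (Fin m) ω) ω
      {z | Fin.snoc (α := fun _ => α) z.1 z.2 ∈ S}).symm)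
  rw [← mass_comp_equiv (Fin.snocEquiv fun _ : Fin (m + 1) => α)]
  congr 1
  funext z
  simp [piWeight, Fin.snocEquiv, Fin.prod_univ_castSucc, mul_comm]

lemma sum_mul_mass_le_of_le (hω : IsWeight ω) {h : α → ℝ} {c : ℝ} (hc : ∀ a, h a ≤ c) :
    ∑ a, ω a * h a ≤ c := by
  calc ∑ a, ω a * h a ≤ ∑ a, ω a * c :=
        Finset.sum_le_sum fun a _ => mul_le_mul_of_nonneg_left (hc a) (hω.nonneg a)
    _ = c := by rw [← Finset.sum_mul, hω.sum_eq_one, one_mul]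

lemma sum_mul_le_mass_add (hω : IsWeight ω) {h : α → ℝ} {c : ℝ} (hc0 : 0 ≤ c) (S : Set α)
    (h1 : ∀ a, h a ≤ 1) (hc : ∀ a, a ∉ S → h a ≤ c) :
    ∑ a, ω a * h a ≤ mass ω S + c := by
  calc ∑ a, ω a * h a ≤ ∑ a, (S.indicator ω a + ω a * c) := by
        refine Finset.sum_le_sum fun a _ => ?_
        have h0 := hω.nonneg a
        by_cases ha : a ∈ S
        · rw [Set.indicator_of_mem ha]
          nlinarith [h1 a, mul_nonneg h0 hc0]
        · rw [Set.indicator_of_notMem ha, zero_add]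
          exact mul_le_mul_of_nonneg_left (hc a ha) h0
    _ = mass ω S + c := by
        rw [Finset.sum_add_distrib, ← Finset.sum_mul, hω.sum_eq_one, one_mul, mass]

/-- Coordinates outside `J` are independent of the coordinates in `J`. -/
lemma mass_piWeight_indep [DecidableEq ι] (J : Finset ι) (A : Set ({i // i ∉ J} → α))
    (W : Set α) :
    mass (piWeight ι ω) {x | (fun i : {i // i ∉ J} => x i) ∈ A ∧ ∀ j ∈ J, x j ∈ W} =
      mass (piWeight {i // i ∉ J} ω) A * mass ω W ^ J.card := by
  classical
  have hW : mass ω W ^ J.card =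
      mass (piWeight {i // i ∈ J} ω) {x | ∀ j, x j ∈ W} := by
    have h := Finset.prod_univ_sum (fun _ : {i // i ∈ J} => (Finset.univ : Finset α))
      (fun _ a => W.indicator ω a)
    simp only [Finset.prod_const, Fintype.piFinset_univ, Finset.card_univ,
      Fintype.card_coe] at h
    rw [mass, h, mass]
    refine Finset.sum_congr rfl fun x _ => ?_
    by_cases hx : ∀ j, x j ∈ W
    · rw [Set.indicator_of_mem (show x ∈ {x : {i // i ∈ J} → α | ∀ j, x j ∈ W} from hx)]
      exact Finset.prod_congr rfl fun j _ => Set.indicator_of_mem (hx j) _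
    · rw [Set.indicator_of_notMem (show x ∉ {x : {i // i ∈ J} → α | ∀ j, x j ∈ W} from hx)]
      push Not at hx
      obtain ⟨j, hj⟩ := hx
      exact Finset.prod_eq_zero (Finset.mem_univ j) (Set.indicator_of_notMem hj _)
  rw [hW]
  have h2 : mass (piWeight {i // i ∉ J} ω) A * mass (piWeight {i // i ∈ J} ω)
      {x | ∀ j, x j ∈ W} = mass (fun z : ({i // i ∈ J} → α) × ({i // i ∉ J} → α) =>
        piWeight {i // i ∈ J} ω z.1 * piWeight {i // i ∉ J} ω z.2)
        {z | z.2 ∈ A ∧ ∀ j, z.1 j ∈ W} := by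
    unfold mass
    rw [Fintype.sum_prod_type, Finset.sum_mul_sum, Finset.sum_comm]
    refine Finset.sum_congr rfl fun a _ => Finset.sum_congr rfl fun b _ => ?_
    by_cases h1 : b ∈ A <;> by_cases h2 : ∀ j, a j ∈ W <;>
      simp [Set.indicator_apply, h1, h2, mul_comm]
  rw [h2, ← mass_comp_equiv (Equiv.piEquivPiSubtypeProd (fun i => i ∈ J) fun _ => α)]
  have hfun : (fun b : ι → α => piWeight {i // i ∈ J} ω
      ((Equiv.piEquivPiSubtypeProd (fun i => i ∈ J) fun _ => α) b).1 *
      piWeight {i // i ∉ J} ω ((Equiv.piEquivPiSubtypeProd (fun i => i ∈ J) fun _ => α) b).2)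
      = piWeight ι ω := by
    funext x
    simp only [piWeight, Equiv.piEquivPiSubtypeProd_apply]
    convert Fintype.prod_subtype_mul_prod_subtype (fun i => i ∈ J) fun i => ω (x i)
  rw [hfun]
  congr 1
  ext x
  simp

end Mass

section Swap

variable {K V : Type*} [Field K] [AddCommGroup V] [Module K V]

/-- An independent family in the span of `x` can replace at least as many members of `x`. -/
lemma exists_span_exchange [FiniteDimensional K V] {m r : ℕ} (x : Fin m → V) (y : Fin r → V)
    (hy : LinearIndependent K y) (hyx : ∀ i, y i ∈ Submodule.span K (Set.range x)) :
    ∃ J : Finset (Fin m), r ≤ J.card ∧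
      Submodule.span K (Set.range (fun i : {i // i ∉ J} => x i) ∪ Set.range y) =
        Submodule.span K (Set.range x) := by
  classical
  obtain ⟨b, hbt, hyb, htb, hb⟩ := exists_linearIndepOn_id_extension
    (hy.linearIndepOn_id) (Set.subset_union_left (s := Set.range y) (t := Set.range x))
  have hbfin : b.Finite := hb.setFinite
  have hspan : Submodule.span K b = Submodule.span K (Set.range x) := by
    apply le_antisymm
    · rw [Submodule.span_le]
      refine hbt.trans (Set.union_subset ?_ Submodule.subset_span)
      rintro _ ⟨i, rfl⟩
      exact hyx i
    · rw [Submodule.span_le]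
      exact Set.subset_union_right.trans htb
  have hcard : b.ncard ≤ m := by
    have h1 : Module.finrank K (Submodule.span K b) = b.ncard := by
      have := hbfin.fintype
      rw [finrank_span_set_eq_card hb, Set.ncard_eq_toFinset_card']
    rw [← h1, hspan]
    simpa [Set.finrank] using finrank_range_le_card (R := K) x
  have hycard : (Set.range y).ncard = r := by
    rw [← Set.image_univ, Set.ncard_image_of_injective _ hy.injective, Set.ncard_univ]
    simp
  have hsec : ∀ v ∈ b \ Set.range y, ∃ i, x i = v := fun v hv =>
    (hbt hv.1).resolve_left hv.2
  choose g hg using hsec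
  let D : Finset V := (hbfin.subset (Set.sdiff_subset (t := Set.range y))).toFinset
  have hD : D.card + r ≤ m := by
    have h1 : D.card = (b \ Set.range y).ncard := by
      rw [Set.ncard_eq_toFinset_card _ (hbfin.subset (Set.sdiff_subset (t := Set.range y)))]
    have h2 := Set.ncard_sdiff_add_ncard_of_subset hyb hbfin
    omega
  have hDmem : ∀ v, v ∈ D ↔ v ∈ b \ Set.range y := fun v => by simp [D]
  refine ⟨(D.attach.image fun v : D => g v.1 ((hDmem v).1 v.2))ᶜ, ?_, ?_⟩
  · rw [Finset.card_compl, Fintype.card_fin]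
    have := Finset.card_image_le (s := D.attach) (f := fun v : D => g v.1 ((hDmem v).1 v.2))
    rw [Finset.card_attach] at this
    omega
  · apply le_antisymm
    · rw [Submodule.span_le]
      refine Set.union_subset ?_ ?_
      · rintro _ ⟨i, rfl⟩
        exact Submodule.subset_span ⟨i, rfl⟩
      · rintro _ ⟨i, rfl⟩
        exact hyx i
    · rw [← hspan]
      refine Submodule.span_mono fun v hv => ?_
      by_cases hvy : v ∈ Set.range y
      · exact Or.inr hvy
      · refine Or.inl ⟨⟨g v ⟨hv, hvy⟩, ?_⟩, hg v ⟨hv, hvy⟩⟩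
        simp only [Finset.mem_compl, not_not, Finset.mem_image, Finset.mem_attach, true_and]
        exact ⟨⟨v, (hDmem v).2 ⟨hv, hvy⟩⟩, rfl⟩

variable [Fintype V]

/-- Lower bound for the mass of independent families inside a subspace. -/
lemma pow_le_mass_linearIndependent {ω : V → ℝ} (hω : IsWeight ω) (W : Submodule K V) {β : ℝ}
    (r : ℕ) (hβ : β ≤ mass ω (W : Set V))
    (h : ∀ U : Submodule K V, Module.finrank K U < r → mass ω (U : Set V) ≤ β) :
    (mass ω (W : Set V) - β) ^ r ≤
      mass (piWeight (Fin r) ω) {y | (∀ i, y i ∈ W) ∧ LinearIndependent K y} := by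
  induction r with
  | zero =>
    have : {y : Fin 0 → V | (∀ i, y i ∈ W) ∧ LinearIndependent K y} = Set.univ := by
      ext y
      simp
    rw [this, mass_univ hω.piWeight, pow_zero]
  | succ r ih =>
    specialize ih fun U hU => h U (by omega)
    rw [mass_piWeight_snoc, pow_succ]
    calc _ ≤ mass (piWeight (Fin r) ω) {y | (∀ i, y i ∈ W) ∧ LinearIndependent K y} *
          (mass ω (W : Set V) - β) := mul_le_mul_of_nonneg_right ih (sub_nonneg.2 hβ)
      _ ≤ _ := by
        rw [mass, Finset.sum_mul]
        refine Finset.sum_le_sum fun y _ => ?_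
        by_cases hy : (∀ i, y i ∈ W) ∧ LinearIndependent K y
        · rw [Set.indicator_of_mem (show y ∈
            {y : Fin r → V | (∀ i, y i ∈ W) ∧ LinearIndependent K y} from hy)]
          refine mul_le_mul_of_nonneg_left ?_ (hω.piWeight.nonneg y)
          have h1 : (W : Set V) ⊆ {a | Fin.snoc (α := fun _ => V) y a ∈
              {y : Fin (r + 1) → V | (∀ i, y i ∈ W) ∧ LinearIndependent K y}} ∪
              (Submodule.span K (Set.range y) : Set V) := by
            intro a ha
            by_cases hay : a ∈ Submodule.span K (Set.range y)
            · exact Or.inr hay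
            · refine Or.inl ⟨fun i => ?_, linearIndependent_finSnoc.2 ⟨hy.2, hay⟩⟩
              refine Fin.lastCases ?_ (fun j => ?_) i
              · simpa using ha
              · simpa using hy.1 j
          have h2 := (mass_mono hω h1).trans (mass_union_le hω _ _)
          have h3 := h (Submodule.span K (Set.range y)) (by
            have := finrank_range_le_card (R := K) y
            simp only [Fintype.card_fin] at this
            exact Nat.lt_succ_of_le this)
          linarith
        · rw [Set.indicator_of_notMem (show y ∉
            {y : Fin r → V | (∀ i, y i ∈ W) ∧ LinearIndependent K y} from hy), zero_mul]
          exact mul_nonneg (hω.piWeight.nonneg y) (mass_nonneg hω _)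

/-- Replacing part of a random family by a lazier one: a random family is unlikely to span a
subspace that is much more likely for the lazier distribution. -/
lemma mass_span_bad_le [FiniteDimensional K V] {ω ω' : V → ℝ} (hω : IsWeight ω)
    (hω' : IsWeight ω')
    (bad : Submodule K V → Prop) (m r : ℕ) {κ β : ℝ} (hκ : 0 ≤ κ) (hβ0 : 0 < β)
    (hκb : ∀ W, bad W → mass ω (W : Set V) ≤ κ * mass ω' (W : Set V))
    (hβ : ∀ W, bad W → 2 * β ≤ mass ω' (W : Set V))
    (hU : ∀ U : Submodule K V, Module.finrank K U < r → mass ω' (U : Set V) ≤ β) :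
    mass (piWeight (Fin m) ω) {x | bad (Submodule.span K (Set.range x))} ≤
      2 ^ m * (2 * κ) ^ r := by
  classical
  let 𝒲 : Finset (Submodule K V) :=
    (Finset.univ.image fun x : Fin m → V => Submodule.span K (Set.range x)).filter bad
  let b : Finset (Fin m) → Submodule K V → ℝ := fun J W =>
    mass (fun z : (Fin r → V) × ({i // i ∉ J} → V) =>
      piWeight (Fin r) ω' z.1 * piWeight {i // i ∉ J} ω z.2)
      {z | Submodule.span K (Set.range z.2 ∪ Set.range z.1) = W}
  have hprod : ∀ J : Finset (Fin m), IsWeight (fun z : (Fin r → V) × ({i // i ∉ J} → V) =>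
      piWeight (Fin r) ω' z.1 * piWeight {i // i ∉ J} ω z.2) := fun J =>
    { nonneg := fun z => mul_nonneg (hω'.piWeight.nonneg _) (hω.piWeight.nonneg _)
      sum_eq_one := by
        rw [Fintype.sum_prod_type]
        simp_rw [← Finset.mul_sum, hω.piWeight.sum_eq_one, mul_one]
        exact hω'.piWeight.sum_eq_one }
  have hb : ∀ J, ∑ W ∈ 𝒲, b J W ≤ 1 := fun J => sum_mass_fiber_le (hprod J) 𝒲 _
  have hb0 : ∀ J W, 0 ≤ b J W := fun J W => mass_nonneg (hprod J) _
  have key : ∀ W, bad W →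
      mass (piWeight (Fin m) ω) {x | Submodule.span K (Set.range x) = W} ≤
        (2 * κ) ^ r * ∑ J : Finset (Fin m), b J W := by
    intro W hW
    set ρ' := mass ω' (W : Set V) with hρ'
    have h1 : (ρ' / 2) ^ r ≤
        mass (piWeight (Fin r) ω') {y | (∀ i, y i ∈ W) ∧ LinearIndependent K y} := by
      refine le_trans (pow_le_pow_left₀ (by linarith [hβ W hW]) ?_ r)
        (pow_le_mass_linearIndependent hω' W r (by linarith [hβ W hW]) hU)
      linarith [hβ W hW]
    set a := mass (piWeight (Fin m) ω) {x | Submodule.span K (Set.range x) = W} with ha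
    have ha0 : 0 ≤ a := mass_nonneg hω.piWeight _
    have h2 : mass (piWeight (Fin r) ω') {y | (∀ i, y i ∈ W) ∧ LinearIndependent K y} * a ≤
        ∑ J ∈ Finset.univ.filter (fun J : Finset (Fin m) => r ≤ J.card),
          ∑ y, piWeight (Fin r) ω' y * mass (piWeight (Fin m) ω)
            {x | (fun i : {i // i ∉ J} => x i) ∈
              {u | Submodule.span K (Set.range u ∪ Set.range y) = W} ∧ ∀ j ∈ J, x j ∈ W} := by
      rw [mass, Finset.sum_mul, Finset.sum_comm]
      refine Finset.sum_le_sum fun y _ => ?_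
      rw [← Finset.mul_sum]
      by_cases hy : (∀ i, y i ∈ W) ∧ LinearIndependent K y
      · rw [Set.indicator_of_mem (show y ∈
          {y : Fin r → V | (∀ i, y i ∈ W) ∧ LinearIndependent K y} from hy)]
        refine mul_le_mul_of_nonneg_left ?_ (hω'.piWeight.nonneg y)
        refine le_trans (mass_mono hω.piWeight ?_) (mass_exists_le hω.piWeight _ _)
        intro x hx
        have hx' : Submodule.span K (Set.range x) = W := hx
        obtain ⟨J, hJ, hJs⟩ := exists_span_exchange x y hy.2 fun i => hx' ▸ hy.1 i
        refine ⟨J, by simpa using hJ, hJs.trans hx', fun j _ => ?_⟩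
        rw [← hx']
        exact Submodule.subset_span ⟨j, rfl⟩
      · rw [Set.indicator_of_notMem (show y ∉
          {y : Fin r → V | (∀ i, y i ∈ W) ∧ LinearIndependent K y} from hy), zero_mul]
        exact mul_nonneg (hω'.piWeight.nonneg y)
          (Finset.sum_nonneg fun _ _ => mass_nonneg hω.piWeight _)
    have hρ0 : 0 < ρ' := by linarith [hβ W hW]
    have h3 : ∀ J ∈ Finset.univ.filter (fun J : Finset (Fin m) => r ≤ J.card),
        ∑ y, piWeight (Fin r) ω' y * mass (piWeight (Fin m) ω)
            {x | (fun i : {i // i ∉ J} => x i) ∈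
              {u | Submodule.span K (Set.range u ∪ Set.range y) = W} ∧ ∀ j ∈ J, x j ∈ W}
          ≤ b J W * (κ * ρ') ^ r := by
      intro J hJ
      have e0 : ∀ y : Fin r → V, piWeight (Fin r) ω' y * mass (piWeight (Fin m) ω)
          {x | (fun i : {i // i ∉ J} => x i) ∈
            {u | Submodule.span K (Set.range u ∪ Set.range y) = W} ∧ ∀ j ∈ J, x j ∈ W} =
          piWeight (Fin r) ω' y * mass (piWeight {i // i ∉ J} ω)
            {u | Submodule.span K (Set.range u ∪ Set.range y) = W} *
            mass ω (W : Set V) ^ J.card := fun y => by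
        rw [mul_assoc]
        exact congrArg _ (mass_piWeight_indep J _ _)
      rw [Finset.sum_congr rfl fun y _ => e0 y, ← Finset.sum_mul]
      have e : ∑ y, piWeight (Fin r) ω' y * mass (piWeight {i // i ∉ J} ω)
          {u | Submodule.span K (Set.range u ∪ Set.range y) = W} = b J W :=
        (mass_prod_eq _ _ {z : (Fin r → V) × ({i // i ∉ J} → V) |
          Submodule.span K (Set.range z.2 ∪ Set.range z.1) = W}).symm
      rw [e]
      refine mul_le_mul_of_nonneg_left ?_ (hb0 J W)
      refine (pow_le_pow_of_le_one (mass_nonneg hω _) (mass_le_one hω _)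
        (Finset.mem_filter.1 hJ).2).trans ?_
      exact pow_le_pow_left₀ (mass_nonneg hω _) (hκb W hW) r
    have h4 : (ρ' / 2) ^ r * a ≤ (∑ J : Finset (Fin m), b J W) * (κ * ρ') ^ r := by
      refine (mul_le_mul_of_nonneg_right h1 ha0).trans (h2.trans ?_)
      refine (Finset.sum_le_sum h3).trans ?_
      rw [← Finset.sum_mul]
      refine mul_le_mul_of_nonneg_right ?_ (by positivity)
      exact Finset.sum_le_sum_of_subset_of_nonneg (Finset.subset_univ _) fun J _ _ => hb0 J W
    have h5 : (κ * ρ') ^ r = (2 * κ) ^ r * (ρ' / 2) ^ r := by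
      rw [← mul_pow]; congr 1; ring
    rw [h5] at h4
    have h6 : 0 < (ρ' / 2) ^ r := by positivity
    refine le_of_mul_le_mul_left (h4.trans_eq ?_) h6
    ring
  calc mass (piWeight (Fin m) ω) {x | bad (Submodule.span K (Set.range x))}
      ≤ mass (piWeight (Fin m) ω) {x | ∃ W ∈ 𝒲, Submodule.span K (Set.range x) = W} := by
        refine mass_mono hω.piWeight fun x hx => ⟨_, ?_, rfl⟩
        simp only [𝒲, Finset.mem_filter, Finset.mem_image, Finset.mem_univ, true_and]
        exact ⟨⟨x, rfl⟩, hx⟩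
    _ ≤ ∑ W ∈ 𝒲, mass (piWeight (Fin m) ω) {x | Submodule.span K (Set.range x) = W} :=
        mass_exists_le hω.piWeight _ _
    _ ≤ ∑ W ∈ 𝒲, (2 * κ) ^ r * ∑ J : Finset (Fin m), b J W :=
        Finset.sum_le_sum fun W hW => key W (Finset.mem_filter.1 hW).2
    _ = (2 * κ) ^ r * ∑ J : Finset (Fin m), ∑ W ∈ 𝒲, b J W := by
        rw [← Finset.mul_sum, Finset.sum_comm]
    _ ≤ (2 * κ) ^ r * ∑ J : Finset (Fin m), 1 := by
        refine mul_le_mul_of_nonneg_left (Finset.sum_le_sum fun J _ => hb J) (by positivity)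
    _ = 2 ^ m * (2 * κ) ^ r := by
        simp [mul_comm]

end Swap

section Odlyzko

variable {K : Type*} [Field K] [Fintype K] {ν : K → ℝ} {α : ℝ}

/-- Odlyzko's bound, for subsets of a coset of `U`. -/
lemma mass_le_pow_of_sub_mem (hν : IsWeight ν) (hα0 : 0 ≤ α) (hα1 : α ≤ 1)
    (hα : ∀ a, ν a ≤ α) (N : ℕ) (U : Submodule K (Fin N → K)) (A : Set (Fin N → K))
    (hA : ∀ x ∈ A, ∀ y ∈ A, x - y ∈ U) :
    mass (piWeight (Fin N) ν) A ≤ α ^ (N - Module.finrank K U) := by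
  induction N with
  | zero => simpa using mass_le_one hν.piWeight A
  | succ N ih =>
    let c : (Fin N → K) →ₗ[K] (Fin (N + 1) → K) :=
      { toFun := fun x => Fin.cons 0 x
        map_add' := fun x y => by
          ext i; refine Fin.cases ?_ (fun j => ?_) i <;> simp
        map_smul' := fun a x => by
          ext i; refine Fin.cases ?_ (fun j => ?_) i <;> simp }
    have hc : Function.Injective c := fun x y h =>
      Fin.cons_right_injective (α := fun _ => K) 0 h
    let U₀ := U.comap c
    have hmap : Module.finrank K (U₀.map c) = Module.finrank K U₀ :=
      (Submodule.equivMapOfInjective c hc U₀).finrank_eq.symm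
    have hle : U₀.map c ≤ U := Submodule.map_comap_le _ _
    have hfib : ∀ a, mass (piWeight (Fin N) ν)
        {x | Fin.cons (α := fun _ => K) a x ∈ A} ≤ α ^ (N - Module.finrank K U₀) := by
      intro a
      refine ih U₀ _ fun x hx y hy => ?_
      have h := hA _ hx _ hy
      have e : c (x - y) = Fin.cons (α := fun _ => K) a x - Fin.cons (α := fun _ => K) a y := by
        ext i; refine Fin.cases ?_ (fun j => ?_) i <;> simp [c]
      change c (x - y) ∈ U
      rwa [e]
    rw [mass_piWeight_cons]
    by_cases h0 : ∀ u ∈ U, u 0 = 0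
    · have hfin : Module.finrank K U₀ ≤ Module.finrank K U := by
        rw [← hmap]; exact Submodule.finrank_mono hle
      by_cases hne : A.Nonempty
      · obtain ⟨z, hz⟩ := hne
        rw [Finset.sum_eq_single_of_mem (z 0) (Finset.mem_univ _)]
        · have h1 : Module.finrank K U₀ ≤ N := by
            simpa using Submodule.finrank_le U₀
          calc _ ≤ α * α ^ (N - Module.finrank K U₀) :=
                mul_le_mul (hα _) (hfib _) (mass_nonneg hν.piWeight _) hα0
            _ = α ^ (N + 1 - Module.finrank K U₀) := by
                rw [← pow_succ', Nat.succ_sub h1]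
            _ ≤ _ := pow_le_pow_of_le_one hα0 hα1 (by omega)
        · intro a _ ha
          have : {x | Fin.cons (α := fun _ => K) a x ∈ A} = ∅ := by
            ext x
            simp only [Set.mem_ofPred_eq, Set.mem_empty_iff_false, iff_false]
            intro hx
            apply ha
            have := h0 _ (hA _ hx _ hz)
            simpa [sub_eq_zero] using this
          rw [this, mass_empty, mul_zero]
      · rw [Set.not_nonempty_iff_eq_empty] at hne
        subst hne
        simp only [Set.mem_empty_iff_false, Set.ofPred_false, mass_empty, mul_zero,
          Finset.sum_const_zero]
        positivity
    · push Not at h0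
      obtain ⟨u, hu, hu0⟩ := h0
      have hlt : U₀.map c < U := by
        refine lt_of_le_of_ne hle fun h => hu0 ?_
        rw [← h] at hu
        obtain ⟨x, -, rfl⟩ := hu
        simp [c]
      have hfin := Submodule.finrank_lt_finrank_of_lt hlt
      rw [hmap] at hfin
      refine (sum_mul_mass_le_of_le hν hfib).trans ?_
      exact pow_le_pow_of_le_one hα0 hα1 (by omega)

lemma mass_submodule_le (hν : IsWeight ν) (hα0 : 0 ≤ α) (hα1 : α ≤ 1)
    (hα : ∀ a, ν a ≤ α) {N : ℕ} (U : Submodule K (Fin N → K)) :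
    mass (piWeight (Fin N) ν) (U : Set (Fin N → K)) ≤ α ^ (N - Module.finrank K U) :=
  mass_le_pow_of_sub_mem hν hα0 hα1 hα N U _ fun _ hx _ hy => U.sub_mem hx hy

open Matrix in
lemma mass_dotProduct_eq_zero_le (hν : IsWeight ν) (hα0 : 0 ≤ α) (hα1 : α ≤ 1)
    (hα : ∀ a, ν a ≤ α) {N : ℕ} {w : Fin N → K} (hw : w ≠ 0) :
    mass (piWeight (Fin N) ν) {v | w ⬝ᵥ v = 0} ≤ α := by
  classical
  let U : Submodule K (Fin N → K) :=
    { carrier := {v | w ⬝ᵥ v = 0}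
      add_mem' := fun {a b} ha hb => by
        simp only [Set.mem_ofPred_eq] at *
        rw [dotProduct_add, ha, hb, add_zero]
      zero_mem' := by simp
      smul_mem' := fun c x hx => by
        simp only [Set.mem_ofPred_eq] at *
        rw [dotProduct_smul, hx, smul_zero] }
  have hU : U < ⊤ := by
    rw [lt_top_iff_ne_top]
    intro h
    apply hw
    ext i
    have : Pi.single i 1 ∈ U := h ▸ Submodule.mem_top
    have h' : w ⬝ᵥ Pi.single i 1 = 0 := this
    simpa using h'
  have h1 := Submodule.finrank_lt hU.ne
  simp only [Module.finrank_fin_fun] at h1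
  refine (mass_submodule_le hν hα0 hα1 hα U).trans ?_
  calc α ^ (N - Module.finrank K U) ≤ α ^ 1 := pow_le_pow_of_le_one hα0 hα1 (by omega)
    _ = α := pow_one α

open Matrix in
/-- A random family of `m` vectors rarely has a nonzero orthogonal vector in a space of small
dimension. -/
lemma mass_exists_orthogonal_le {N : ℕ} {ω : (Fin N → K) → ℝ} (hω : IsWeight ω)
    (hhalf : ∀ w : Fin N → K, w ≠ 0 → mass ω {v | w ⬝ᵥ v = 0} ≤ 1 / 2) (m : ℕ)
    (A : Submodule K (Fin N → K)) :
    mass (piWeight (Fin m) ω) {x | ∃ w ∈ A, w ≠ 0 ∧ ∀ j, w ⬝ᵥ x j = 0} ≤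
      4 ^ Module.finrank K A * (5 / 8) ^ m := by
  classical
  induction m generalizing A with
  | zero =>
    refine (mass_le_one hω.piWeight _).trans ?_
    simpa using one_le_pow₀ (by norm_num : (1 : ℝ) ≤ 4)
  | succ m ih =>
    by_cases hA : A = ⊥
    · have : {x : Fin (m + 1) → Fin N → K | ∃ w ∈ A, w ≠ 0 ∧ ∀ j, w ⬝ᵥ x j = 0} = ∅ := by
        ext x
        simp only [Set.mem_ofPred_eq, Set.mem_empty_iff_false, iff_false]
        rintro ⟨w, hw, hw0, -⟩
        rw [hA] at hw
        exact hw0 (by simpa using hw)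
      rw [this, mass_empty]
      positivity
    · obtain ⟨w₀, hw₀, hne⟩ := Submodule.exists_mem_ne_zero_of_ne_bot hA
      rw [mass_piWeight_cons]
      set d := Module.finrank K A with hd
      have hstep : ∀ a : Fin N → K, mass (piWeight (Fin m) ω)
          {x | Fin.cons (α := fun _ => Fin N → K) a x ∈
            {x : Fin (m + 1) → Fin N → K | ∃ w ∈ A, w ≠ 0 ∧ ∀ j, w ⬝ᵥ x j = 0}} ≤
          4 ^ d * (5 / 8) ^ m * (if w₀ ⬝ᵥ a = 0 then 1 else 1 / 4) := by
        intro a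
        split_ifs with h
        · rw [mul_one]
          refine (mass_mono hω.piWeight ?_).trans (ih A)
          rintro x ⟨w, hw, hw0, hx⟩
          exact ⟨w, hw, hw0, fun j => by simpa using hx j.succ⟩
        · let A' : Submodule K (Fin N → K) :=
            { carrier := {w | w ∈ A ∧ w ⬝ᵥ a = 0}
              add_mem' := fun {u v} hu hv =>
                ⟨A.add_mem hu.1 hv.1, by rw [add_dotProduct, hu.2, hv.2, add_zero]⟩
              zero_mem' := ⟨A.zero_mem, by simp⟩
              smul_mem' := fun c x hx =>
                ⟨A.smul_mem c hx.1, by rw [smul_dotProduct, hx.2, smul_zero]⟩ }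
          have hlt : A' < A := by
            refine lt_of_le_of_ne (fun w hw => hw.1) fun e => h ?_
            have : w₀ ∈ A' := e ▸ hw₀
            exact this.2
          have hfin := Submodule.finrank_lt_finrank_of_lt hlt
          refine (mass_mono hω.piWeight ?_).trans ((ih A').trans ?_)
          · rintro x ⟨w, hw, hw0, hx⟩
            exact ⟨w, ⟨hw, by simpa using hx 0⟩, hw0, fun j => by simpa using hx j.succ⟩
          · have h4 : (4 : ℝ) ^ Module.finrank K A' ≤ 4 ^ d * (1 / 4) := by
              have : (4 : ℝ) ^ (Module.finrank K A' + 1) ≤ 4 ^ d :=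
                pow_le_pow_right₀ (by norm_num) hfin
              rw [pow_succ] at this
              linarith
            nlinarith [pow_pos (by norm_num : (0 : ℝ) < 5 / 8) m]
      have hsum : ∑ a, ω a * (if w₀ ⬝ᵥ a = 0 then (1 : ℝ) else 1 / 4) ≤ 5 / 8 := by
        have e : ∀ a, ω a * (if w₀ ⬝ᵥ a = 0 then (1 : ℝ) else 1 / 4) =
            ω a * (1 / 4) + Set.indicator {v | w₀ ⬝ᵥ v = 0} ω a * (3 / 4) := by
          intro a
          by_cases h : w₀ ⬝ᵥ a = 0
          · rw [Set.indicator_of_mem (show a ∈ {v | w₀ ⬝ᵥ v = 0} from h), if_pos h]; ring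
          · rw [Set.indicator_of_notMem (show a ∉ {v | w₀ ⬝ᵥ v = 0} from h), if_neg h]; ring
        simp_rw [e]
        rw [Finset.sum_add_distrib, ← Finset.sum_mul, ← Finset.sum_mul, hω.sum_eq_one]
        have := hhalf w₀ hne
        rw [mass] at this
        linarith
      calc _ ≤ ∑ a, ω a * (4 ^ d * (5 / 8) ^ m * (if w₀ ⬝ᵥ a = 0 then 1 else 1 / 4)) :=
            Finset.sum_le_sum fun a _ => mul_le_mul_of_nonneg_left (hstep a) (hω.nonneg a)
        _ = 4 ^ d * (5 / 8) ^ m * ∑ a, ω a * (if w₀ ⬝ᵥ a = 0 then 1 else 1 / 4) := by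
            rw [Finset.mul_sum]
            exact Finset.sum_congr rfl fun a _ => by ring
        _ ≤ 4 ^ d * (5 / 8) ^ m * (5 / 8) := by gcongr
        _ = 4 ^ d * (5 / 8) ^ (m + 1) := by ring

open Matrix in
/-- A random family rarely has a nonzero orthogonal vector of small support. -/
lemma mass_exists_sparse_orthogonal_le [DecidableEq K] {N : ℕ} {ω : (Fin N → K) → ℝ}
    (hω : IsWeight ω)
    (hhalf : ∀ w : Fin N → K, w ≠ 0 → mass ω {v | w ⬝ᵥ v = 0} ≤ 1 / 2) (m s : ℕ) :
    mass (piWeight (Fin m) ω) {x | ∃ w : Fin N → K, w ≠ 0 ∧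
      (Finset.univ.filter fun i => w i ≠ 0).card ≤ s ∧ ∀ j, w ⬝ᵥ x j = 0} ≤
      (4 * N) ^ s * (5 / 8) ^ m := by
  let A : (Fin s → Fin N) → Submodule K (Fin N → K) := fun g =>
    Submodule.span K (Set.range fun i => Pi.single (g i) 1)
  have hA : ∀ g, Module.finrank K (A g) ≤ s := fun g => by
    simpa [Set.finrank] using finrank_range_le_card (R := K)
      fun i : Fin s => (Pi.single (g i) 1 : Fin N → K)
  calc _ ≤ mass (piWeight (Fin m) ω) {x | ∃ g ∈ (Finset.univ : Finset (Fin s → Fin N)),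
        ∃ w ∈ A g, w ≠ 0 ∧ ∀ j, w ⬝ᵥ x j = 0} := by
        refine mass_mono hω.piWeight ?_
        rintro x ⟨w, hw0, hws, hwx⟩
        set S := Finset.univ.filter fun i => w i ≠ 0 with hS
        have hSne : S.Nonempty := by
          obtain ⟨i, hi⟩ := Function.ne_iff.1 hw0
          exact ⟨i, by simpa [hS] using hi⟩
        obtain ⟨i₀, hi₀⟩ := hSne
        let g : Fin s → Fin N := fun k =>
          if h : (k : ℕ) < S.card then S.equivFin.symm ⟨k, h⟩ else i₀
        refine ⟨g, Finset.mem_univ _, w, ?_, hw0, hwx⟩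
        have hw : w = ∑ i ∈ S, w i • (Pi.single i 1 : Fin N → K) := by
          ext k
          simp only [Finset.sum_apply, Pi.smul_apply, smul_eq_mul, Pi.single_apply, mul_ite,
            mul_one, mul_zero, Finset.sum_ite_eq]
          split_ifs with h
          · rfl
          · simpa [hS] using h
        rw [hw]
        refine Submodule.sum_mem _ fun i hi => Submodule.smul_mem _ _ (Submodule.subset_span ?_)
        have hk := (S.equivFin ⟨i, hi⟩).isLt
        refine ⟨⟨S.equivFin ⟨i, hi⟩, hk.trans_le hws⟩, ?_⟩
        simp [g, hk]
    _ ≤ ∑ g : Fin s → Fin N, mass (piWeight (Fin m) ω)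
        {x | ∃ w ∈ A g, w ≠ 0 ∧ ∀ j, w ⬝ᵥ x j = 0} := mass_exists_le hω.piWeight _ _
    _ ≤ ∑ g : Fin s → Fin N, 4 ^ s * (5 / 8) ^ m := by
        refine Finset.sum_le_sum fun g _ => (mass_exists_orthogonal_le hω hhalf m (A g)).trans ?_
        gcongr
        · norm_num
        · exact hA g
    _ = (4 * N) ^ s * (5 / 8) ^ m := by
        simp [mul_pow]; ring

end Odlyzko

section LevelSets

lemma ofReal_sum_eq_lintegral_card {γ : Type*} (R : Finset γ) (H : γ → ℝ)
    (hH : ∀ x ∈ R, 0 ≤ H x) :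
    ENNReal.ofReal (∑ x ∈ R, H x) =
      ∫⁻ c in Set.Ioi (0 : ℝ), ((R.filter fun x => c ≤ H x).card : ENNReal) := by
  have e : ∀ c : ℝ, ((R.filter fun x => c ≤ H x).card : ENNReal) =
      ∑ x ∈ R, (Set.Iic (H x)).indicator (fun _ => (1 : ENNReal)) c := fun c => by
    rw [Finset.card_filter]
    push_cast
    refine Finset.sum_congr rfl fun x _ => ?_
    simp [Set.indicator_apply]
  simp_rw [e]
  rw [lintegral_finsetSum _ fun x _ => measurable_const.indicator measurableSet_Iic,
    ENNReal.ofReal_sum_of_nonneg hH]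
  refine Finset.sum_congr rfl fun x hx => ?_
  rw [lintegral_indicator measurableSet_Iic, Measure.restrict_restrict measurableSet_Iic,
    setLIntegral_const, one_mul, Set.inter_comm, Set.Ioi_inter_Iic, Real.volume_Ioc, sub_zero]

/-- A discrete layer-cake comparison. -/
lemma mul_sum_le_sum_of_card_le {α β : Type*} (S : Finset α) (T : Finset β) (F : α → ℝ)
    (G : β → ℝ) (hF : ∀ x ∈ S, 0 ≤ F x) (hG : ∀ y ∈ T, 0 ≤ G y) (k : ℕ)
    (h : ∀ c : ℝ, 0 < c →
      k * (S.filter fun x => c ≤ F x).card ≤ (T.filter fun y => c ≤ G y).card) :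
    k * ∑ x ∈ S, F x ≤ ∑ y ∈ T, G y := by
  have hS : 0 ≤ ∑ x ∈ S, F x := Finset.sum_nonneg hF
  rw [← ENNReal.ofReal_le_ofReal_iff (Finset.sum_nonneg hG), ENNReal.ofReal_mul (by positivity),
    ofReal_sum_eq_lintegral_card S F hF,
    ofReal_sum_eq_lintegral_card T G hG, ENNReal.ofReal_natCast,
    ← lintegral_const_mul' _ _ (by simp)]
  refine setLIntegral_mono' measurableSet_Ioi fun c hc => ?_
  exact_mod_cast h c hc

variable {p : ℕ} [Fact p.Prime] {Q : ZMod p → ℝ}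

open Pointwise in
lemma two_mul_card_sublevel_le (h0 : Q 0 = 0) (hadd : ∀ s t, Q (s + t) ≤ 2 * (Q s + Q t))
    {u : ℝ} (hu : 0 ≤ u)
    (h : (Finset.univ.filter fun t => t ≠ 0 ∧ Q t ≤ 4 * u).card < p - 1) :
    2 * (Finset.univ.filter fun t => t ≠ 0 ∧ Q t ≤ u).card ≤
      (Finset.univ.filter fun t => t ≠ 0 ∧ Q t ≤ 4 * u).card := by
  have e : ∀ v : ℝ, 0 ≤ v → (Finset.univ.filter fun t => Q t ≤ v).card =
      (Finset.univ.filter fun t => t ≠ 0 ∧ Q t ≤ v).card + 1 := by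
    intro v hv
    rw [← Finset.card_insert_of_notMem (a := (0 : ZMod p)) (by simp)]
    congr 1
    ext t
    by_cases ht : t = 0 <;> simp [ht, h0, hv]
  have hne : (Finset.univ.filter fun t => Q t ≤ u).Nonempty := ⟨0, by simpa [h0] using hu⟩
  have hcd := ZMod.cauchy_davenport (p := p) Fact.out hne hne
  have hsub : (Finset.univ.filter fun t => Q t ≤ u) + (Finset.univ.filter fun t => Q t ≤ u) ⊆
      (Finset.univ.filter fun t => Q t ≤ 4 * u) := by
    intro t ht
    obtain ⟨a, ha, b, hb, rfl⟩ := Finset.mem_add.1 ht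
    simp only [Finset.mem_filter, Finset.mem_univ, true_and] at ha hb ⊢
    linarith [hadd a b]
  have hcard := Finset.card_le_card hsub
  rw [e u hu] at hcd
  rw [e (4 * u) (by positivity)] at hcard
  have hp : 1 ≤ p := (Fact.out : p.Prime).one_lt.le
  omega

lemma two_pow_mul_card_sublevel_le (h0 : Q 0 = 0)
    (hadd : ∀ s t, Q (s + t) ≤ 2 * (Q s + Q t)) {u : ℝ} (hu : 0 ≤ u) (j : ℕ)
    (h : (Finset.univ.filter fun t => t ≠ 0 ∧ Q t ≤ 4 ^ j * u).card < p - 1) :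
    2 ^ j * (Finset.univ.filter fun t => t ≠ 0 ∧ Q t ≤ u).card ≤
      (Finset.univ.filter fun t => t ≠ 0 ∧ Q t ≤ 4 ^ j * u).card := by
  induction j with
  | zero => simp
  | succ j ih =>
    have hpos : 0 ≤ 4 ^ j * u := by positivity
    rw [pow_succ', mul_assoc] at h
    have h1 : (Finset.univ.filter fun t => t ≠ 0 ∧ Q t ≤ 4 ^ j * u).card ≤
        (Finset.univ.filter fun t => t ≠ 0 ∧ Q t ≤ 4 * (4 ^ j * u)).card := by
      refine Finset.card_le_card fun t ht => ?_
      simp only [Finset.mem_filter, Finset.mem_univ, true_and] at ht ⊢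
      exact ⟨ht.1, by linarith [ht.2]⟩
    have h2 := ih (by omega)
    have h3 := two_mul_card_sublevel_le h0 hadd hpos h
    rw [pow_succ' (4 : ℝ), mul_assoc (4 : ℝ), pow_succ, mul_comm (2 ^ j) 2, mul_assoc]
    omega

/-- Doubling of sublevel sets turns into a gain for exponential sums. -/
lemma two_pow_mul_sum_exp_le (h0 : Q 0 = 0) (hnn : ∀ t, 0 ≤ Q t)
    (hadd : ∀ s t, Q (s + t) ≤ 2 * (Q s + Q t)) {s : ℝ} (hQ : p * s ≤ ∑ t, Q t) (j : ℕ) :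
    2 ^ j * ∑ t ∈ Finset.univ.filter (fun t : ZMod p => t ≠ 0), Real.exp (-(Q t / 2)) ≤
      ∑ t ∈ Finset.univ.filter (fun t : ZMod p => t ≠ 0), Real.exp (-(Q t / 4 ^ j / 2)) +
        2 ^ j * (p * Real.exp (-(s / 4 ^ j / 2))) := by
  have hp : 1 < p := (Fact.out : p.Prime).one_lt
  set T := Finset.univ.filter (fun t : ZMod p => t ≠ 0) with hT
  have hTcard : T.card = p - 1 := by
    rw [hT, Finset.filter_ne', Finset.card_erase_of_mem (Finset.mem_univ _), Finset.card_univ,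
      ZMod.card]
  have hmain : ((2 ^ j : ℕ) : ℝ) * ∑ t ∈ T.filter (fun t => 4 ^ j * Q t < s),
      Real.exp (-(Q t / 2)) ≤ ∑ t ∈ T, Real.exp (-(Q t / 4 ^ j / 2)) := by
    refine mul_sum_le_sum_of_card_le _ _ _ _ (fun _ _ => (Real.exp_pos _).le)
      (fun _ _ => (Real.exp_pos _).le) _ fun c hc => ?_
    set S := (T.filter (fun t => 4 ^ j * Q t < s)).filter fun t => c ≤ Real.exp (-(Q t / 2))
      with hS
    rcases S.eq_empty_or_nonempty with hemp | hne
    · simp [hemp]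
    obtain ⟨t₀, ht₀, hmax⟩ := S.exists_max_image Q hne
    have ht₀' : 4 ^ j * Q t₀ < s ∧ c ≤ Real.exp (-(Q t₀ / 2)) := by
      simp only [hS, Finset.mem_filter] at ht₀
      exact ⟨ht₀.1.2, ht₀.2⟩
    have h1 : S.card ≤ (Finset.univ.filter fun t => t ≠ 0 ∧ Q t ≤ Q t₀).card := by
      refine Finset.card_le_card fun t ht => ?_
      have := hmax t ht
      simp only [hS, hT, Finset.mem_filter, Finset.mem_univ, true_and] at ht ⊢
      exact ⟨ht.1.1, this⟩
    have h2 : (Finset.univ.filter fun t => t ≠ 0 ∧ Q t ≤ 4 ^ j * Q t₀).card < p - 1 := by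
      by_contra hcon
      have heq : (Finset.univ.filter fun t => t ≠ 0 ∧ Q t ≤ 4 ^ j * Q t₀) = T := by
        refine Finset.eq_of_subset_of_card_le (fun t ht => ?_) (by omega)
        simp only [hT, Finset.mem_filter, Finset.mem_univ, true_and] at ht ⊢
        exact ht.1
      have hle : ∑ t, Q t ≤ (p - 1 : ℕ) * (4 ^ j * Q t₀) := by
        rw [← hTcard, ← nsmul_eq_mul, ← Finset.sum_erase Finset.univ h0, hT,
          Finset.filter_ne']
        refine Finset.sum_le_card_nsmul _ _ _ fun t ht => ?_
        have : t ∈ T := by simpa [hT] using ht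
        rw [← heq] at this
        exact (Finset.mem_filter.1 this).2.2
      have hp1 : ((p - 1 : ℕ) : ℝ) = p - 1 := by
        rw [Nat.cast_sub hp.le, Nat.cast_one]
      rw [hp1] at hle
      have hp2 : (1 : ℝ) < p := by exact_mod_cast hp
      have := hnn t₀
      have h4 : 0 ≤ 4 ^ j * Q t₀ := by positivity
      nlinarith
    have h3 := two_pow_mul_card_sublevel_le h0 hadd (hnn t₀) j h2
    calc 2 ^ j * S.card ≤ 2 ^ j * (Finset.univ.filter fun t => t ≠ 0 ∧ Q t ≤ Q t₀).card := by
          gcongr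
      _ ≤ _ := h3
      _ ≤ _ := by
          refine Finset.card_le_card fun t ht => ?_
          simp only [hT, Finset.mem_filter, Finset.mem_univ, true_and] at ht ⊢
          refine ⟨ht.1, ht₀'.2.trans (Real.exp_le_exp.2 ?_)⟩
          have : Q t / 4 ^ j ≤ Q t₀ := by
            rw [div_le_iff₀ (by positivity)]; linarith [ht.2]
          linarith
  have hrest : ∑ t ∈ T.filter (fun t => ¬ 4 ^ j * Q t < s), Real.exp (-(Q t / 2)) ≤
      p * Real.exp (-(s / 4 ^ j / 2)) := by
    calc _ ≤ (T.filter (fun t => ¬ 4 ^ j * Q t < s)).card • Real.exp (-(s / 4 ^ j / 2)) := by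
          refine Finset.sum_le_card_nsmul _ _ _ fun t ht => Real.exp_le_exp.2 ?_
          have h1 := (Finset.mem_filter.1 ht).2
          have : s / 4 ^ j ≤ Q t := by
            rw [div_le_iff₀ (by positivity)]; linarith
          linarith
      _ ≤ _ := by
          rw [nsmul_eq_mul]
          refine mul_le_mul_of_nonneg_right ?_ (Real.exp_pos _).le
          have : (T.filter (fun t => ¬ 4 ^ j * Q t < s)).card ≤ p :=
            (Finset.card_filter_le _ _).trans (by omega)
          exact_mod_cast this
  rw [← Finset.sum_filter_add_sum_filter_not T (fun t => 4 ^ j * Q t < s), mul_add]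
  push_cast at hmain
  have : (0 : ℝ) < 2 ^ j := by positivity
  nlinarith

end LevelSets

section Fourier

open Matrix

/-- The lazy walk step: `1` and `-1` with probability `μ / 2` each, and `0` otherwise. -/
noncomputable def lazyWeight (p : ℕ) (μ : ℝ) (x : ZMod p) : ℝ :=
  (if x = 0 then 1 - μ else 0) + (if x = 1 then μ / 2 else 0) + (if x = -1 then μ / 2 else 0)

variable {p : ℕ} [Fact p.Prime] {μ : ℝ}

lemma isWeight_lazyWeight (h0 : 0 ≤ μ) (h1 : μ ≤ 1) : IsWeight (lazyWeight p μ) where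
  nonneg x := by
    unfold lazyWeight
    have : 0 ≤ 1 - μ := by linarith
    have : 0 ≤ μ / 2 := by linarith
    refine add_nonneg (add_nonneg ?_ ?_) ?_ <;> split_ifs <;> first | assumption | exact le_rfl
  sum_eq_one := by
    simp only [lazyWeight, Finset.sum_add_distrib, Finset.sum_ite_eq', Finset.mem_univ, if_true]
    ring

lemma lazyWeight_le (h1 : μ ≤ 1 / 2) (x : ZMod p) : lazyWeight p μ x ≤ 1 - μ := by
  unfold lazyWeight
  by_cases hx : x = 0
  · subst hx
    have h01 : (0 : ZMod p) ≠ -1 := by simp [eq_comm]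
    simp [h01]
  · rw [if_neg hx]
    split_ifs <;> linarith

/-- The real part of `1 - e(a / p)`. -/
noncomputable def charGap (a : ZMod p) : ℝ := 1 - (ZMod.stdAddChar a).re

lemma charGap_zero : charGap (0 : ZMod p) = 0 := by simp [charGap]

lemma two_mul_charGap (a : ZMod p) : 2 * charGap a = ‖1 - ZMod.stdAddChar a‖ ^ 2 := by
  have h : ‖ZMod.stdAddChar a‖ = 1 := AddChar.norm_apply _ _
  have h2 : ‖ZMod.stdAddChar a‖ ^ 2 = 1 := by rw [h, one_pow]
  rw [Complex.sq_norm, Complex.normSq_apply] at h2 ⊢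
  simp only [charGap, Complex.sub_re, Complex.one_re, Complex.sub_im, Complex.one_im]
  linarith

lemma charGap_nonneg (a : ZMod p) : 0 ≤ charGap a := by
  have := two_mul_charGap a
  nlinarith [sq_nonneg ‖1 - ZMod.stdAddChar a‖]

lemma charGap_le_two (a : ZMod p) : charGap a ≤ 2 := by
  have h : ‖ZMod.stdAddChar a‖ = 1 := AddChar.norm_apply _ _
  have := (abs_le.1 (Complex.abs_re_le_norm (ZMod.stdAddChar a))).1
  rw [h] at this
  unfold charGap
  linarith

lemma charGap_add_le (a b : ZMod p) : charGap (a + b) ≤ 2 * (charGap a + charGap b) := by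
  have h : ‖ZMod.stdAddChar a‖ = 1 := AddChar.norm_apply _ _
  have e : 1 - ZMod.stdAddChar (a + b) =
      (1 - ZMod.stdAddChar a) + ZMod.stdAddChar a * (1 - ZMod.stdAddChar b) := by
    rw [AddChar.map_add_eq_mul]; ring
  have h1 : ‖1 - ZMod.stdAddChar (a + b)‖ ≤
      ‖1 - ZMod.stdAddChar a‖ + ‖1 - ZMod.stdAddChar b‖ := by
    rw [e]
    refine (norm_add_le _ _).trans ?_
    rw [norm_mul, h, one_mul]
  have h2 := two_mul_charGap a
  have h3 := two_mul_charGap b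
  have h4 := two_mul_charGap (a + b)
  nlinarith [norm_nonneg (1 - ZMod.stdAddChar (a + b)), norm_nonneg (1 - ZMod.stdAddChar a),
    norm_nonneg (1 - ZMod.stdAddChar b),
    sq_nonneg (‖1 - ZMod.stdAddChar a‖ - ‖1 - ZMod.stdAddChar b‖)]

lemma sum_charGap_mul {c : ZMod p} (hc : c ≠ 0) : ∑ t : ZMod p, charGap (t * c) = p := by
  have h := AddChar.sum_mulShift (R := ZMod p) (R' := ℂ) c (ZMod.isPrimitive_stdAddChar p)
  rw [if_neg hc] at h
  have h2 := congrArg Complex.re h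
  rw [Complex.re_sum] at h2
  simp only [charGap, Finset.sum_sub_distrib, h2]
  simp [ZMod.card]

lemma sum_lazyWeight_mul_stdAddChar (a : ZMod p) :
    ∑ x, (lazyWeight p μ x : ℂ) * ZMod.stdAddChar (a * x) = ((1 - μ * charGap a : ℝ) : ℂ) := by
  have h : ∀ x : ZMod p, (lazyWeight p μ x : ℂ) * ZMod.stdAddChar (a * x) =
      (if x = 0 then ((1 - μ : ℝ) : ℂ) * ZMod.stdAddChar (a * x) else 0) +
      (if x = 1 then ((μ / 2 : ℝ) : ℂ) * ZMod.stdAddChar (a * x) else 0) +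
      (if x = -1 then ((μ / 2 : ℝ) : ℂ) * ZMod.stdAddChar (a * x) else 0) := by
    intro x
    unfold lazyWeight
    push_cast
    split_ifs <;> simp <;> ring
  simp_rw [h, Finset.sum_add_distrib, Finset.sum_ite_eq', Finset.mem_univ, if_true]
  rw [mul_zero, mul_one, mul_neg_one, AddChar.map_zero_eq_one, AddChar.map_neg_eq_conj]
  apply Complex.ext
  · simp [charGap]; ring
  · simp [charGap]

variable {N : ℕ}

/-- The orthogonal complement for the dot product. -/
def perp {K : Type*} [Field K] (W : Submodule K (Fin N → K)) : Submodule K (Fin N → K) where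
  carrier := {w | ∀ v ∈ W, w ⬝ᵥ v = 0}
  add_mem' ha hb v hv := by rw [add_dotProduct, ha v hv, hb v hv, add_zero]
  zero_mem' v _ := zero_dotProduct v
  smul_mem' c w hw v hv := by rw [smul_dotProduct, hw v hv, smul_zero]

lemma mem_perp_span {K : Type*} [Field K] {m : ℕ} {x : Fin m → Fin N → K} {w : Fin N → K} :
    w ∈ perp (Submodule.span K (Set.range x)) ↔ ∀ j, w ⬝ᵥ x j = 0 := by
  refine ⟨fun h j => h _ (Submodule.subset_span ⟨j, rfl⟩), fun h v hv => ?_⟩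
  induction hv using Submodule.span_induction with
  | mem v hv => obtain ⟨j, rfl⟩ := hv; exact h j
  | zero => exact dotProduct_zero w
  | add a b _ _ ha hb => rw [dotProduct_add, ha, hb, add_zero]
  | smul c a _ ha => rw [dotProduct_smul, ha, smul_zero]

lemma exists_mem_perp_of_notMem {K : Type*} [Field K] {W : Submodule K (Fin N → K)}
    {v : Fin N → K} (hv : v ∉ W) : ∃ w ∈ perp W, w ⬝ᵥ v ≠ 0 := by
  obtain ⟨f, hf, hW⟩ := W.exists_le_ker_of_notMem hv
  have key : ∀ u, (fun i => f (Pi.single i 1)) ⬝ᵥ u = f u := fun u => by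
    conv_rhs => rw [pi_eq_sum_univ' u, map_sum]
    simp [dotProduct, mul_comm]
  refine ⟨fun i => f (Pi.single i 1), fun u hu => ?_, ?_⟩
  · rw [key]; exact hW hu
  · rw [key]; exact hf

lemma pow_le_card_perp_span {m : ℕ} (x : Fin m → Fin N → ZMod p) :
    p ^ (N - m) ≤ Nat.card (perp (Submodule.span (ZMod p) (Set.range x))) := by
  let f : (Fin N → ZMod p) →ₗ[ZMod p] (Fin m → ZMod p) := Matrix.mulVecLin (Matrix.of x)
  have hker : f.ker = perp (Submodule.span (ZMod p) (Set.range x)) := by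
    ext w
    rw [mem_perp_span, LinearMap.mem_ker]
    simp only [f, Matrix.mulVecLin_apply, funext_iff, Matrix.mulVec, Pi.zero_apply]
    exact forall_congr' fun j => by rw [dotProduct_comm]; rfl
  have h1 := f.finrank_range_add_finrank_ker
  have h2 := Submodule.finrank_le f.range
  rw [Module.finrank_fin_fun] at h1 h2
  rw [← hker, Module.natCard_eq_pow_finrank (K := ZMod p), Nat.card_zmod]
  exact Nat.pow_le_pow_right (Fact.out : p.Prime).pos (by omega)

lemma sum_perp_stdAddChar (W : Submodule (ZMod p) (Fin N → ZMod p)) [Fintype (perp W)]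
    (v : Fin N → ZMod p) [Decidable (v ∈ W)] :
    ∑ w : perp W, ZMod.stdAddChar ((w : Fin N → ZMod p) ⬝ᵥ v) =
      if v ∈ W then (Nat.card (perp W) : ℂ) else 0 := by
  classical
  let f : perp W →+ ZMod p :=
    { toFun := fun w => (w : Fin N → ZMod p) ⬝ᵥ v
      map_zero' := zero_dotProduct v
      map_add' := fun a b => add_dotProduct _ _ v }
  have h := AddChar.sum_eq_ite ((ZMod.stdAddChar (N := p)).compAddMonoidHom f)
  have h0 : (ZMod.stdAddChar (N := p)).compAddMonoidHom f = 0 ↔ v ∈ W := by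
    constructor
    · intro h0
      by_contra hv
      obtain ⟨w, hw, hwv⟩ := exists_mem_perp_of_notMem hv
      have h1 := DFunLike.congr_fun h0 ⟨w, hw⟩
      refine hwv (ZMod.injective_stdAddChar ?_)
      rw [AddChar.map_zero_eq_one]
      exact h1
    · intro hv
      ext w
      have : f w = 0 := w.2 v hv
      simp [this]
  simp only [h0] at h
  rw [Nat.card_eq_fintype_card]
  exact h

/-- The Fourier transform of a product of lazy steps. -/
noncomputable def lazyFourier (μ : ℝ) (w : Fin N → ZMod p) : ℝ := ∏ i, (1 - μ * charGap (w i))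

lemma sum_piWeight_mul_stdAddChar (w : Fin N → ZMod p) :
    ∑ v, (piWeight (Fin N) (lazyWeight p μ) v : ℂ) * ZMod.stdAddChar (w ⬝ᵥ v) =
      (lazyFourier μ w : ℂ) := by
  have h := Finset.prod_univ_sum (fun _ : Fin N => (Finset.univ : Finset (ZMod p)))
    (fun i x => (lazyWeight p μ x : ℂ) * ZMod.stdAddChar (w i * x))
  simp only [sum_lazyWeight_mul_stdAddChar, Fintype.piFinset_univ] at h
  rw [lazyFourier, Complex.ofReal_prod, h]
  refine Finset.sum_congr rfl fun v _ => ?_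
  rw [Finset.prod_mul_distrib, piWeight, Complex.ofReal_prod, dotProduct]
  congr 1
  exact (map_prod (ZMod.stdAddChar (N := p)).toMonoidHom
    (fun i => Multiplicative.ofAdd (w i * v i)) Finset.univ)

lemma card_mul_mass_coset (W : Submodule (ZMod p) (Fin N → ZMod p)) [Fintype (perp W)]
    (a : Fin N → ZMod p) :
    ((Nat.card (perp W) * mass (piWeight (Fin N) (lazyWeight p μ)) {v | v + a ∈ W} : ℝ) : ℂ) =
      ∑ w : perp W, ZMod.stdAddChar ((w : Fin N → ZMod p) ⬝ᵥ a) *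
        (lazyFourier μ (w : Fin N → ZMod p) : ℂ) := by
  classical
  simp_rw [← sum_piWeight_mul_stdAddChar, Finset.mul_sum]
  rw [Finset.sum_comm, mass]
  push_cast
  rw [Finset.mul_sum]
  refine Finset.sum_congr rfl fun v _ => ?_
  calc _ = (piWeight (Fin N) (lazyWeight p μ) v : ℂ) *
        (if v + a ∈ W then (Nat.card (perp W) : ℂ) else 0) := by
        simp only [Set.indicator_apply, Set.mem_ofPred_eq]
        split_ifs <;> push_cast <;> ring
    _ = _ := by
        rw [← sum_perp_stdAddChar, Finset.mul_sum]
        refine Finset.sum_congr rfl fun w _ => ?_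
        rw [dotProduct_add, AddChar.map_add_eq_mul]
        ring

lemma card_mul_mass_submodule (W : Submodule (ZMod p) (Fin N → ZMod p)) [Fintype (perp W)] :
    Nat.card (perp W) * mass (piWeight (Fin N) (lazyWeight p μ)) (W : Set (Fin N → ZMod p)) =
      ∑ w : perp W, lazyFourier μ (w : Fin N → ZMod p) := by
  have h := card_mul_mass_coset (μ := μ) W 0
  simp only [dotProduct_zero, AddChar.map_zero_eq_one, one_mul, add_zero] at h
  exact_mod_cast h

lemma one_sub_mul_charGap_nonneg (h0 : 0 ≤ μ) (h1 : μ ≤ 1 / 2) (a : ZMod p) :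
    0 ≤ 1 - μ * charGap a := by
  nlinarith [charGap_nonneg a, charGap_le_two a]

lemma card_perp_pos (W : Submodule (ZMod p) (Fin N → ZMod p)) : (0 : ℝ) < Nat.card (perp W) := by
  exact_mod_cast Nat.card_pos

lemma mass_coset_le (h0 : 0 ≤ μ) (h1 : μ ≤ 1 / 2) (W : Submodule (ZMod p) (Fin N → ZMod p))
    (a : Fin N → ZMod p) :
    mass (piWeight (Fin N) (lazyWeight p μ)) {v | v + a ∈ W} ≤
      mass (piWeight (Fin N) (lazyWeight p μ)) (W : Set (Fin N → ZMod p)) := by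
  classical
  have hc := card_perp_pos W
  refine le_of_mul_le_mul_left ?_ hc
  rw [card_mul_mass_submodule]
  have h := card_mul_mass_coset (μ := μ) W a
  have h2 := congrArg norm h
  rw [Complex.norm_real] at h2
  refine (le_abs_self _).trans (h2.le.trans ((norm_sum_le _ _).trans ?_))
  refine Finset.sum_le_sum fun w _ => ?_
  have h3 : 0 ≤ lazyFourier μ (w : Fin N → ZMod p) :=
    Finset.prod_nonneg fun i _ => one_sub_mul_charGap_nonneg h0 h1 _
  rw [norm_mul, AddChar.norm_apply, one_mul, Complex.norm_real, Real.norm_of_nonneg h3]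

lemma lazyFourier_le_exp (h0 : 0 ≤ μ) (h1 : μ ≤ 1 / 2) (w : Fin N → ZMod p) :
    lazyFourier μ w ≤ Real.exp (-(μ * ∑ i, charGap (w i))) := by
  rw [Finset.mul_sum, ← Finset.sum_neg_distrib, Real.exp_sum]
  refine Finset.prod_le_prod (fun i _ => one_sub_mul_charGap_nonneg h0 h1 _) fun i _ => ?_
  have := Real.add_one_le_exp (-(μ * charGap (w i)))
  linarith

lemma exp_neg_two_mul_le {x : ℝ} (h0 : 0 ≤ x) (h1 : x ≤ 1 / 2) : Real.exp (-(2 * x)) ≤ 1 - x := by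
  have h := Real.add_one_le_exp (2 * x)
  rw [Real.exp_neg, inv_le_comm₀ (Real.exp_pos _) (by linarith)]
  refine le_trans ?_ h
  rw [inv_le_iff_one_le_mul₀ (by linarith)]
  nlinarith

lemma exp_le_lazyFourier (h0 : 0 ≤ μ) (h1 : μ ≤ 1 / 4) (w : Fin N → ZMod p) :
    Real.exp (-(2 * μ * ∑ i, charGap (w i))) ≤ lazyFourier μ w := by
  rw [Finset.mul_sum, ← Finset.sum_neg_distrib, Real.exp_sum]
  refine Finset.prod_le_prod (fun i _ => (Real.exp_pos _).le) fun i _ => ?_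
  have h2 := charGap_nonneg (w i)
  have h3 := charGap_le_two (w i)
  rw [mul_assoc]
  exact exp_neg_two_mul_le (by positivity) (by nlinarith)

lemma sum_filter_ne_zero_lazyFourier_le {j : ℕ} {s : ℝ} {w : Fin N → ZMod p}
    (hs : s ≤ (Finset.univ.filter fun i => w i ≠ 0).card) :
    2 ^ j * ∑ t ∈ Finset.univ.filter (fun t : ZMod p => t ≠ 0), lazyFourier (1 / 2) (t • w) ≤
      ∑ t ∈ Finset.univ.filter (fun t : ZMod p => t ≠ 0), lazyFourier (1 / 4 / 4 ^ j) (t • w) +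
        2 ^ j * (p * Real.exp (-(s / 4 ^ j / 2))) := by
  have hQ : (p : ℝ) * s ≤ ∑ t : ZMod p, ∑ i, charGap (t * w i) := by
    rw [Finset.sum_comm]
    calc (p : ℝ) * s ≤ p * (Finset.univ.filter fun i => w i ≠ 0).card := by gcongr
      _ = ∑ i ∈ Finset.univ.filter (fun i => w i ≠ 0), ∑ t : ZMod p, charGap (t * w i) := by
          rw [Finset.sum_congr rfl fun i hi => sum_charGap_mul (Finset.mem_filter.1 hi).2,
            Finset.sum_const, nsmul_eq_mul, mul_comm]
      _ ≤ _ := Finset.sum_le_sum_of_subset_of_nonneg (Finset.filter_subset _ _)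
          fun i _ _ => Finset.sum_nonneg fun t _ => charGap_nonneg _
  have h := two_pow_mul_sum_exp_le (Q := fun t : ZMod p => ∑ i, charGap (t * w i))
    (by simp [charGap_zero]) (fun t => Finset.sum_nonneg fun i _ => charGap_nonneg _)
    (fun t u => by
      rw [← Finset.sum_add_distrib, Finset.mul_sum]
      exact Finset.sum_le_sum fun i _ => by rw [add_mul]; exact charGap_add_le _ _) hQ j
  have h4 : (1 : ℝ) ≤ 4 ^ j := one_le_pow₀ (by norm_num)
  refine le_trans ?_ (h.trans (add_le_add_left (Finset.sum_le_sum fun t _ => ?_) _))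
  · refine mul_le_mul_of_nonneg_left (Finset.sum_le_sum fun t _ => ?_) (by positivity)
    refine (lazyFourier_le_exp (by norm_num) le_rfl _).trans (Real.exp_le_exp.2 ?_)
    simp only [Pi.smul_apply, smul_eq_mul]
    linarith
  · refine le_trans (Real.exp_le_exp.2 ?_) (exp_le_lazyFourier (by positivity) ?_ _)
    · simp only [Pi.smul_apply, smul_eq_mul]
      apply le_of_eq
      ring
    · exact div_le_self (by norm_num) h4

/-- A subspace without sparse orthogonal vectors gets much more mass from lazier steps. -/
lemma mass_le_of_support_perp (j : ℕ) (s : ℝ) (W : Submodule (ZMod p) (Fin N → ZMod p))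
    (hW : ∀ w ∈ perp W, w ≠ 0 → s ≤ (Finset.univ.filter fun i => w i ≠ 0).card) :
    mass (piWeight (Fin N) (lazyWeight p (1 / 2))) (W : Set (Fin N → ZMod p)) ≤
      1 / Nat.card (perp W) +
      1 / 2 ^ j * mass (piWeight (Fin N) (lazyWeight p (1 / 4 / 4 ^ j)))
        (W : Set (Fin N → ZMod p)) +
      2 * Real.exp (-(s / 4 ^ j / 2)) := by
  classical
  have hp : 1 < p := (Fact.out : p.Prime).one_lt
  have hp2 : (2 : ℝ) ≤ p := by exact_mod_cast hp
  have hc := card_perp_pos W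
  set E := Real.exp (-(s / 4 ^ j / 2)) with hE
  have hE0 : 0 < E := Real.exp_pos _
  set S := Finset.univ.filter (fun w : perp W => w ≠ 0) with hS
  set T := Finset.univ.filter (fun t : ZMod p => t ≠ 0) with hT
  have hTcard : (T.card : ℝ) = p - 1 := by
    rw [hT, Finset.filter_ne', Finset.card_erase_of_mem (Finset.mem_univ _), Finset.card_univ,
      ZMod.card, Nat.cast_sub hp.le, Nat.cast_one]
  have hScard : (S.card : ℝ) ≤ Nat.card (perp W) := by
    rw [Nat.card_eq_fintype_card]
    exact_mod_cast (Finset.card_filter_le _ _)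
  have hscale : ∀ g : (Fin N → ZMod p) → ℝ,
      (p - 1) * ∑ w ∈ S, g w = ∑ w ∈ S, ∑ t ∈ T, g (t • (w : Fin N → ZMod p)) := by
    intro g
    rw [Finset.sum_comm, ← hTcard, ← nsmul_eq_mul, ← Finset.sum_const]
    refine Finset.sum_congr rfl fun t ht => ?_
    have ht0 : t ≠ 0 := (Finset.mem_filter.1 ht).2
    refine Finset.sum_bij' (fun w _ => t⁻¹ • w) (fun w _ => t • w) ?_ ?_ ?_ ?_ ?_
    · intro w hw
      simpa [hS, ht0] using hw
    · intro w hw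
      simpa [hS, ht0] using hw
    · intro w _
      simp [smul_smul, ht0]
    · intro w _
      simp [smul_smul, ht0]
    · intro w _
      simp [smul_smul, ht0]
  have hsplit : ∀ ν : ℝ, ∑ w : perp W, lazyFourier ν (w : Fin N → ZMod p) =
      1 + ∑ w ∈ S, lazyFourier ν (w : Fin N → ZMod p) := by
    intro ν
    rw [hS, Finset.filter_ne', ← Finset.add_sum_erase _ _ (Finset.mem_univ (0 : perp W))]
    congr 1
    simp [lazyFourier, charGap_zero]
  have hmain : 2 ^ j * ((p - 1) * ∑ w ∈ S, lazyFourier (1 / 2) (w : Fin N → ZMod p)) ≤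
      (p - 1) * ∑ w ∈ S, lazyFourier (1 / 4 / 4 ^ j) (w : Fin N → ZMod p) +
        S.card * (2 ^ j * (p * E)) := by
    rw [hscale, hscale, ← nsmul_eq_mul S.card, ← Finset.sum_const, ← Finset.sum_add_distrib,
      Finset.mul_sum]
    refine Finset.sum_le_sum fun w hw => sum_filter_ne_zero_lazyFourier_le (hW w w.2 ?_)
    simpa using (Finset.mem_filter.1 hw).2
  have h1 := card_mul_mass_submodule (μ := 1 / 2) W
  have h2 := card_mul_mass_submodule (μ := 1 / 4 / 4 ^ j) W
  rw [hsplit] at h1 h2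
  have h2j : (0 : ℝ) < 2 ^ j := by positivity
  have hmain2 : 2 ^ j * ∑ w ∈ S, lazyFourier (1 / 2) (w : Fin N → ZMod p) ≤
      ∑ w ∈ S, lazyFourier (1 / 4 / 4 ^ j) (w : Fin N → ZMod p) +
        2 ^ j * (2 * (Nat.card (perp W) * E)) := by
    refine le_of_mul_le_mul_left (a := (p : ℝ) - 1) ?_ (by linarith)
    have h3 : (S.card : ℝ) * (2 ^ j * (p * E)) ≤
        Nat.card (perp W) * (2 ^ j * ((2 * (p - 1)) * E)) := by
      gcongr
      linarith
    nlinarith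
  have h5 : 2 ^ j * (Nat.card (perp W) *
      mass (piWeight (Fin N) (lazyWeight p (1 / 2))) (W : Set (Fin N → ZMod p))) ≤
      2 ^ j * 1 + Nat.card (perp W) * mass (piWeight (Fin N) (lazyWeight p (1 / 4 / 4 ^ j)))
        (W : Set (Fin N → ZMod p)) + 2 ^ j * (2 * (Nat.card (perp W) * E)) := by
    rw [h1, h2]
    linarith
  refine le_of_mul_le_mul_left (a := (2 : ℝ) ^ j * Nat.card (perp W)) ?_ (by positivity)
  rw [mul_assoc]
  refine h5.trans (le_of_eq ?_)
  field_simp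

end Fourier

section Rank

open Matrix

variable {p : ℕ} [Fact p.Prime] {N : ℕ}

/-- The law of a random vector of steps modulo `p`, the steps being `1` and `-1` with probability
`1 / 4` each, and `0` otherwise. -/
noncomputable abbrev stepWeight (p N : ℕ) : (Fin N → ZMod p) → ℝ :=
  piWeight (Fin N) (lazyWeight p (1 / 2))

lemma isWeight_stepWeight : IsWeight (stepWeight p N) :=
  (isWeight_lazyWeight (by norm_num) (by norm_num)).piWeight

/-- The error term in the rank estimates. -/
noncomputable def rankError (N s : ℕ) : ℝ :=
  (4 * N) ^ s * (5 / 8) ^ (N / 2) + 2 ^ N * (1 / 32) ^ (N / 2) +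
    4 * Real.exp (-(s / 4 ^ 7 / 2))

lemma rankError_nonneg (N s : ℕ) : 0 ≤ rankError N s := by
  unfold rankError; positivity

lemma sum_mass_span_le_of_half_le {m s : ℕ} (hs : 4 * s ≤ N) :
    ∑ x, piWeight (Fin m) (stepWeight p N) x *
        mass (stepWeight p N) (Submodule.span (ZMod p) (Set.range x) : Set (Fin N → ZMod p)) ≤
      (4 * N) ^ s * (5 / 8) ^ m + 2 ^ m * (1 / 32) ^ (N / 2) +
        (2 / p ^ (N - m) + 4 * Real.exp (-(s / 4 ^ 7 / 2))) := by
  classical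
  have hω : IsWeight (stepWeight p N) := isWeight_stepWeight
  have hω' : IsWeight (piWeight (Fin N) (lazyWeight p (1 / 4 / 4 ^ 7))) :=
    (isWeight_lazyWeight (by norm_num) (by norm_num)).piWeight
  have hp : (0 : ℝ) < p := by exact_mod_cast (Fact.out : p.Prime).pos
  set E := Real.exp (-(s / 4 ^ 7 / 2)) with hE
  have hE0 : 0 < E := Real.exp_pos _
  let bad : Submodule (ZMod p) (Fin N → ZMod p) → Prop := fun W =>
    (∀ w ∈ perp W, w ≠ 0 → (s : ℝ) ≤ (Finset.univ.filter fun i => w i ≠ 0).card) ∧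
      2 / Nat.card (perp W) + 4 * E < mass (stepWeight p N) (W : Set (Fin N → ZMod p))
  have hbad : ∀ W, bad W → mass (stepWeight p N) (W : Set (Fin N → ZMod p)) ≤
      1 / 64 * mass (piWeight (Fin N) (lazyWeight p (1 / 4 / 4 ^ 7)))
        (W : Set (Fin N → ZMod p)) := by
    intro W hW
    have h := mass_le_of_support_perp 7 s W hW.1
    have h2 := hW.2
    rw [show (2 : ℝ) / Nat.card (perp W) = 2 * (1 / Nat.card (perp W)) by ring] at h2
    norm_num at h h2 hE ⊢
    linarith
  have hbadmass := mass_span_bad_le hω hω' bad m (N / 2) (κ := 1 / 64) (β := E) (by norm_num) hE0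
    hbad
    (fun W hW => by
      have h1 := hbad W hW
      have h2 := hW.2
      have : (0 : ℝ) ≤ 2 / Nat.card (perp W) := by positivity
      linarith)
    (fun U hU => by
      refine (mass_submodule_le (α := 1 - 1 / 4 / 4 ^ 7)
        (isWeight_lazyWeight (by norm_num) (by norm_num)) (by norm_num)
        (by norm_num) (fun a => lazyWeight_le (by norm_num) a) U).trans ?_
      have h1 : (1 - 1 / 4 / 4 ^ 7 : ℝ) ≤ Real.exp (-(1 / 4 / 4 ^ 7)) := by
        have := Real.add_one_le_exp (-(1 / 4 / 4 ^ 7 : ℝ))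
        linarith
      refine (pow_le_pow_left₀ (by norm_num) h1 _).trans ?_
      rw [← Real.exp_nat_mul, hE, Real.exp_le_exp]
      have h2 : 2 * s ≤ N - Module.finrank (ZMod p) U := by omega
      have h3 : (2 * s : ℝ) ≤ (N - Module.finrank (ZMod p) U : ℕ) := by exact_mod_cast h2
      norm_num
      linarith)
  have hhalf : ∀ w : Fin N → ZMod p, w ≠ 0 → mass (stepWeight p N) {v | w ⬝ᵥ v = 0} ≤ 1 / 2 :=
    fun w hw => mass_dotProduct_eq_zero_le (isWeight_lazyWeight (by norm_num) (by norm_num))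
      (by norm_num) (by norm_num) (fun a => (lazyWeight_le le_rfl a).trans (by norm_num)) hw
  have hsparse := mass_exists_sparse_orthogonal_le hω hhalf m s
  refine (sum_mul_le_mass_add (hω.piWeight (ι := Fin m)) (c := 2 / p ^ (N - m) + 4 * E)
    (by positivity)
    ({x | ∃ w : Fin N → ZMod p, w ≠ 0 ∧
      (Finset.univ.filter fun i => w i ≠ 0).card ≤ s ∧ ∀ j, w ⬝ᵥ x j = 0} ∪
      {x | bad (Submodule.span (ZMod p) (Set.range x))}) (fun x => mass_le_one hω _)
    fun x hx => ?_).trans ?_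
  · rw [Set.mem_union, not_or] at hx
    obtain ⟨hx1, hx2⟩ := hx
    have hsupp : ∀ w ∈ perp (Submodule.span (ZMod p) (Set.range x)), w ≠ 0 →
        (s : ℝ) ≤ (Finset.univ.filter fun i => w i ≠ 0).card := by
      intro w hw hw0
      by_contra! hlt
      exact hx1 ⟨w, hw0, by exact_mod_cast hlt.le, mem_perp_span.1 hw⟩
    have hle : mass (stepWeight p N) _ ≤ _ := not_lt.1 fun hlt => hx2 ⟨hsupp, hlt⟩
    refine hle.trans ?_
    have hc : (p : ℝ) ^ (N - m) ≤ Nat.card (perp (Submodule.span (ZMod p) (Set.range x))) := by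
      exact_mod_cast pow_le_card_perp_span x
    gcongr
  · refine add_le_add_left ((mass_union_le (hω.piWeight (ι := Fin m)) _ _).trans
      (add_le_add hsparse (hbadmass.trans ?_))) _
    norm_num

lemma sum_mass_span_le {m s : ℕ} (hs : 4 * s ≤ N) (hm : m < N) :
    ∑ x, piWeight (Fin m) (stepWeight p N) x *
        mass (stepWeight p N) (Submodule.span (ZMod p) (Set.range x) : Set (Fin N → ZMod p)) ≤
      2 / p ^ (N - m) + rankError N s := by
  have hω : IsWeight (stepWeight p N) := isWeight_stepWeight
  have hN : (1 : ℝ) ≤ 4 * N := by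
    have : (1 : ℝ) ≤ N := by exact_mod_cast (by omega : 1 ≤ N)
    linarith
  have hN1 : (1 : ℝ) ≤ (4 * N) ^ s := one_le_pow₀ hN
  have hE : 0 < Real.exp (-(s / 4 ^ 7 / 2 : ℝ)) := Real.exp_pos _
  unfold rankError
  rcases le_or_gt (N / 2) m with h | h
  · refine (sum_mass_span_le_of_half_le hs).trans ?_
    have h1 : (5 / 8 : ℝ) ^ m ≤ (5 / 8) ^ (N / 2) :=
      pow_le_pow_of_le_one (by norm_num) (by norm_num) h
    have h2 : (2 : ℝ) ^ m ≤ 2 ^ N := pow_le_pow_right₀ (by norm_num) hm.le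
    have h3 : (4 * N : ℝ) ^ s * (5 / 8) ^ m ≤ (4 * N) ^ s * (5 / 8) ^ (N / 2) := by gcongr
    have h4 : (2 : ℝ) ^ m * (1 / 32) ^ (N / 2) ≤ 2 ^ N * (1 / 32) ^ (N / 2) := by gcongr
    linarith
  · have h1 : ∑ x, piWeight (Fin m) (stepWeight p N) x *
        mass (stepWeight p N) (Submodule.span (ZMod p) (Set.range x) : Set (Fin N → ZMod p)) ≤
        (1 / 2) ^ (N - m) := by
      refine sum_mul_mass_le_of_le (hω.piWeight (ι := Fin m)) fun x => ?_
      refine (mass_submodule_le (α := 1 / 2) (isWeight_lazyWeight (by norm_num) (by norm_num))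
        (by norm_num) (by norm_num)
        (fun a => (lazyWeight_le le_rfl a).trans (by norm_num)) _).trans ?_
      refine pow_le_pow_of_le_one (by norm_num) (by norm_num) (Nat.sub_le_sub_left ?_ _)
      exact (finrank_range_le_card (R := ZMod p) x).trans_eq (Fintype.card_fin m)
    have h2 : (1 / 2 : ℝ) ^ (N - m) ≤ (5 / 8) ^ (N / 2) :=
      (pow_le_pow_of_le_one (by norm_num) (by norm_num) (by omega)).trans
        (pow_le_pow_left₀ (by norm_num) (by norm_num) _)
    have h3 : (5 / 8 : ℝ) ^ (N / 2) ≤ (4 * N) ^ s * (5 / 8) ^ (N / 2) :=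
      le_mul_of_one_le_left (by positivity) hN1
    have h4 : (0 : ℝ) ≤ 2 / p ^ (N - m) := by positivity
    have h5 : (0 : ℝ) ≤ 2 ^ N * (1 / 32) ^ (N / 2) := by positivity
    linarith

lemma sum_mul_le_mass_add_sum {α : Type*} [Fintype α] {ω : α → ℝ} (hω : IsWeight ω) (S : Set α)
    {h g : α → ℝ} (h1 : ∀ a, h a ≤ 1) (hg0 : ∀ a, 0 ≤ g a) (hg : ∀ a, a ∉ S → h a ≤ g a) :
    ∑ a, ω a * h a ≤ mass ω S + ∑ a, ω a * g a := by
  rw [mass, ← Finset.sum_add_distrib]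
  refine Finset.sum_le_sum fun a _ => ?_
  have h0 := hω.nonneg a
  by_cases ha : a ∈ S
  · rw [Set.indicator_of_mem ha]
    nlinarith [h1 a, mul_nonneg h0 (hg0 a)]
  · rw [Set.indicator_of_notMem ha, zero_add]
    exact mul_le_mul_of_nonneg_left (hg a ha) h0

lemma mass_not_linearIndependent_le {m s : ℕ} (hs : 4 * s ≤ N) (hm : m ≤ N) :
    mass (piWeight (Fin m) (stepWeight p N)) {x | ¬ LinearIndependent (ZMod p) x} ≤
      2 / p ^ (N - m) + m * rankError N s := by
  have hω : IsWeight (stepWeight p N) := isWeight_stepWeight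
  have hp : (2 : ℝ) ≤ p := by exact_mod_cast (Fact.out : p.Prime).two_le
  induction m with
  | zero =>
    have : {x : Fin 0 → Fin N → ZMod p | ¬ LinearIndependent (ZMod p) x} = ∅ := by
      ext x
      simp
    rw [this, mass_empty, Nat.cast_zero, zero_mul, add_zero]
    positivity
  | succ m ih =>
    rw [mass_piWeight_snoc]
    have h1 := sum_mul_le_mass_add_sum (hω.piWeight (ι := Fin m))
      {x | ¬ LinearIndependent (ZMod p) x} (fun x => mass_le_one hω
        {a | Fin.snoc (α := fun _ => Fin N → ZMod p) x a ∈ {x | ¬ LinearIndependent (ZMod p) x}})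
      (fun x => mass_nonneg hω
        (Submodule.span (ZMod p) (Set.range x) : Set (Fin N → ZMod p)))
      (fun x hx => mass_mono hω fun a ha => by
        by_contra hcon
        exact ha (linearIndependent_finSnoc.2 ⟨not_not.1 hx, hcon⟩))
    have h2 := ih (by omega)
    have h3 := sum_mass_span_le (p := p) hs (show m < N by omega)
    have h4 : (2 : ℝ) / p ^ (N - m) + 2 / p ^ (N - m) ≤ 2 / p ^ (N - (m + 1)) := by
      rw [show N - m = N - (m + 1) + 1 by omega, pow_succ, ← add_div, div_le_div_iff₀
        (by positivity) (by positivity)]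
      have : (0 : ℝ) < p ^ (N - (m + 1)) := by positivity
      nlinarith
    push_cast
    linarith

lemma mass_piWeight_insertNth {α : Type*} [Fintype α] {ω : α → ℝ} {m : ℕ} (i : Fin (m + 1))
    (S : Set (Fin (m + 1) → α)) :
    mass (piWeight (Fin (m + 1)) ω) S = ∑ a, ω a *
      mass (piWeight (Fin m) ω) {x | i.insertNth (α := fun _ => α) a x ∈ S} := by
  refine Eq.trans ?_ (mass_prod_eq ω (piWeight (Fin m) ω)
    {z | i.insertNth (α := fun _ => α) z.1 z.2 ∈ S})
  rw [← mass_comp_equiv (Fin.insertNthEquiv (fun _ : Fin (m + 1) => α) i)]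
  congr 1
  funext z
  simp [piWeight, Fin.insertNthEquiv, Fin.prod_univ_succAbove _ i]

lemma linearIndependent_insertNth {K V : Type*} [Field K] [AddCommGroup V] [Module K V] {m : ℕ}
    (i : Fin (m + 1)) {x : Fin m → V} (hx : LinearIndependent K x) {a : V}
    (ha : a ∉ Submodule.span K (Set.range x)) :
    LinearIndependent K (i.insertNth (α := fun _ => V) a x) := by
  rw [← Fin.cons_comp_cycleRange]
  exact (linearIndependent_finCons.2 ⟨hx, ha⟩).comp _ i.cycleRange.injective

/-- Combining two columns of a random `M × (M + 2)` array modulo `p` almost always gives an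
invertible square matrix. -/
lemma mass_not_linearIndependent_comb_le {M s : ℕ} (hs : 4 * s ≤ M + 1) (j : Fin (M + 2))
    (i : Fin (M + 1)) {t₁ : ZMod p} (t₂ : ZMod p) (ht : t₁ ≠ 0) :
    mass (piWeight (Fin (M + 2)) (stepWeight p (M + 1)))
      {y | ¬ LinearIndependent (ZMod p) (i.insertNth (α := fun _ => Fin (M + 1) → ZMod p)
        (t₁ • y (j.succAbove i) + t₂ • y j) fun k => y (j.succAbove (i.succAbove k)))} ≤
      4 / p + (M + 1) * rankError (M + 1) s := by
  have hω : IsWeight (stepWeight p (M + 1)) := isWeight_stepWeight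
  rw [mass_piWeight_insertNth j]
  refine sum_mul_mass_le_of_le hω fun b => ?_
  rw [mass_piWeight_insertNth i]
  simp only [Set.mem_ofPred_eq, Fin.insertNth_apply_succAbove, Fin.insertNth_apply_same]
  have h0 := mass_prod_swap (piWeight (Fin M) (stepWeight p (M + 1))) (stepWeight p (M + 1))
    {z | ¬ LinearIndependent (ZMod p) (i.insertNth (α := fun _ => Fin (M + 1) → ZMod p)
      (t₁ • z.2 + t₂ • b) z.1)}
  simp only [Set.mem_ofPred_eq] at h0
  rw [← h0]
  have h1 := sum_mul_le_mass_add_sum (hω.piWeight (ι := Fin M))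
    {x | ¬ LinearIndependent (ZMod p) x} (fun x => mass_le_one hω
      {a | ¬ LinearIndependent (ZMod p) (i.insertNth (α := fun _ => Fin (M + 1) → ZMod p)
        (t₁ • a + t₂ • b) x)})
    (fun x => mass_nonneg hω
      (Submodule.span (ZMod p) (Set.range x) : Set (Fin (M + 1) → ZMod p)))
    (fun x hx => by
      refine le_trans (mass_mono hω fun a ha => ?_)
        (mass_coset_le (by norm_num) le_rfl _ ((t₁⁻¹ * t₂) • b))
      have hmem : t₁ • a + t₂ • b ∈ Submodule.span (ZMod p) (Set.range x) := by
        by_contra hcon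
        exact ha (linearIndependent_insertNth i (not_not.1 hx) hcon)
      have := Submodule.smul_mem _ t₁⁻¹ hmem
      rwa [smul_add, smul_smul, smul_smul, inv_mul_cancel₀ ht, one_smul] at this)
  have h2 := mass_not_linearIndependent_le (p := p) hs (Nat.le_succ M)
  have h3 := sum_mass_span_le (p := p) hs (Nat.lt_succ_self M)
  rw [show M + 1 - M = 1 by omega, pow_one] at h2 h3
  have h4 : (4 : ℝ) / p = 2 / p + 2 / p := by ring
  linarith

end Rank

section Reduction

open Matrix

variable {p : ℕ} [Fact p.Prime]

lemma entryMeasure_real_cast_eq (z : ZMod p) :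
    entryMeasure.real {a : ℤ | (a : ZMod p) = z} = lazyWeight p (1 / 2) z := by
  simp only [entryMeasure, lazyWeight, measureReal_def, Measure.add_apply, Measure.smul_apply,
    Measure.dirac_apply, Set.indicator_apply, Set.mem_ofPred_eq, Pi.one_apply, smul_eq_mul,
    Int.cast_zero, Int.cast_one, Int.cast_neg, eq_comm (b := z)]
  rw [ENNReal.toReal_add (by split_ifs <;> simp) (by split_ifs <;> simp),
    ENNReal.toReal_add (by split_ifs <;> simp) (by split_ifs <;> simp)]
  split_ifs <;> norm_num

lemma matMeasure_real_columns_mem {N : ℕ} (S : Set (Fin (N + 1) → Fin N → ZMod p)) :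
    (matMeasure (N + 1)).real {X | (fun j i => ((X i.succ j : ℤ) : ZMod p)) ∈ S} =
      mass (piWeight (Fin (N + 1)) (stepWeight p N)) S := by
  classical
  have hsingle : ∀ y : Fin (N + 1) → Fin N → ZMod p,
      (matMeasure (N + 1)).real {X | (fun j i => ((X i.succ j : ℤ) : ZMod p)) = y} =
        piWeight (Fin (N + 1)) (stepWeight p N) y := by
    intro y
    have hset : {X : Fin (N + 1) → Fin (N + 1) → ℤ |
        (fun j i => ((X i.succ j : ℤ) : ZMod p)) = y} =
        Set.univ.pi fun i : Fin (N + 1) => Fin.cases (motive := fun _ => Set (Fin (N + 1) → ℤ))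
          Set.univ (fun k => Set.univ.pi fun j => {a : ℤ | (a : ZMod p) = y j k}) i := by
      ext X
      rw [Set.mem_univ_pi, Fin.forall_fin_succ]
      simp only [Set.mem_ofPred_eq, Set.mem_univ_pi, Fin.cases_zero, Fin.cases_succ, Set.mem_univ,
        true_and, funext_iff]
      exact forall_comm
    rw [hset, measureReal_def, matMeasure, Measure.pi_pi, Fin.prod_univ_succ]
    simp only [Fin.cases_zero, Fin.cases_succ, measure_univ, one_mul, vecMeasure, Measure.pi_pi]
    rw [ENNReal.toReal_prod]
    simp_rw [ENNReal.toReal_prod, ← measureReal_def, entryMeasure_real_cast_eq]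
    rw [Finset.prod_comm]
    rfl
  have hunion : {X : Fin (N + 1) → Fin (N + 1) → ℤ |
      (fun j i => ((X i.succ j : ℤ) : ZMod p)) ∈ S} =
      ⋃ y ∈ Finset.univ.filter (· ∈ S), {X : Fin (N + 1) → Fin (N + 1) → ℤ |
        (fun j i => ((X i.succ j : ℤ) : ZMod p)) = y} := by
    ext X
    simp
  rw [hunion, measureReal_biUnion_finset ?_ fun y _ => MeasurableSet.of_discrete]
  · rw [mass, Finset.sum_filter]
    refine Finset.sum_congr rfl fun y _ => ?_
    rw [hsingle, Set.indicator_apply]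
  · intro y _ z _ hyz
    rw [Function.onFun, Set.disjoint_left]
    rintro X hX hX'
    exact hyz (hX.symm.trans hX')

variable {R : Type*} [CommRing R]

lemma det_insertNth {m : ℕ} (i : Fin (m + 1)) (a b : Fin (m + 1) → R) (s t : R)
    (x : Fin m → Fin (m + 1) → R) :
    det (of (i.insertNth (α := fun _ => Fin (m + 1) → R) (s • a + t • b) x)) =
      s * det (of (i.insertNth (α := fun _ => Fin (m + 1) → R) a x)) +
        t * det (of (i.insertNth (α := fun _ => Fin (m + 1) → R) b x)) := by
  have h : ∀ c : Fin (m + 1) → R, of (i.insertNth (α := fun _ => Fin (m + 1) → R) c x) =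
      updateRow (of (i.insertNth (α := fun _ => Fin (m + 1) → R) 0 x)) i c := by
    intro c
    ext k l
    refine Fin.succAboveCases i ?_ (fun k => ?_) k <;> simp
  rw [h, h a, h b, det_updateRow_add, det_updateRow_smul, det_updateRow_smul]

lemma exists_perm_succAbove {m : ℕ} {j j' : Fin (m + 1)} :
    ∃ σ : Equiv.Perm (Fin m), ∀ k, j'.succAbove (σ k) = Equiv.swap j j' (j.succAbove k) := by
  let e : {k // k ≠ j} ≃ {k // k ≠ j'} := (Equiv.swap j j').subtypeEquiv fun k => by
    rw [Ne, Ne, ← Equiv.apply_eq_iff_eq (Equiv.swap j j'), Equiv.swap_apply_left]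
  refine ⟨((finSuccAboveEquiv j).trans e).trans (finSuccAboveEquiv j').symm, fun k => ?_⟩
  have h := congrArg Subtype.val ((finSuccAboveEquiv j').apply_symm_apply
    (e (finSuccAboveEquiv j k)))
  rw [finSuccAboveEquiv_apply] at h
  exact h

/-- A combination of two maximal minors is a single determinant. -/
lemma exists_minor_comb_eq_det {m : ℕ} (j : Fin (m + 2)) (i : Fin (m + 1)) :
    ∃ ε : ℤ, ∀ (y : Fin (m + 2) → Fin (m + 1) → ℤ) (s t : ℤ),
      s * det (of fun k => y (j.succAbove k)) +
        t * det (of fun k => y ((j.succAbove i).succAbove k)) =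
      det (of (i.insertNth (α := fun _ => Fin (m + 1) → ℤ)
        (s • y (j.succAbove i) + (t * ε) • y j) fun k => y (j.succAbove (i.succAbove k)))) := by
  obtain ⟨σ, hσ⟩ := exists_perm_succAbove (j := j) (j' := j.succAbove i)
  refine ⟨Equiv.Perm.sign σ, fun y s t => ?_⟩
  have h1 : of (i.insertNth (α := fun _ => Fin (m + 1) → ℤ) (y (j.succAbove i))
      fun k => y (j.succAbove (i.succAbove k))) = of fun k => y (j.succAbove k) := by
    ext k l
    refine Fin.succAboveCases i ?_ (fun k => ?_) k <;> simp
  have h2 : of (i.insertNth (α := fun _ => Fin (m + 1) → ℤ) (y j)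
      fun k => y (j.succAbove (i.succAbove k))) =
      (of fun k => y ((j.succAbove i).succAbove k)).submatrix σ id := by
    ext k l
    simp only [submatrix_apply, of_apply, hσ, id]
    refine Fin.succAboveCases i ?_ (fun k => ?_) k
    · simp
    · rw [Fin.insertNth_apply_succAbove, Equiv.swap_apply_of_ne_of_ne (Fin.succAbove_ne j _)]
      exact fun h => Fin.succAbove_ne i k (Fin.succAbove_right_injective h)
  rw [det_insertNth, h1, h2, det_permute, mul_assoc, ← mul_assoc (Equiv.Perm.sign σ : ℤ),
    Int.cast_id, ← Units.val_mul, Int.units_mul_self, Units.val_one, one_mul]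

lemma minorDet_eq_det_columns {N : ℕ} (X : Fin (N + 1) → Fin (N + 1) → ℤ) (j : Fin (N + 1)) :
    minorDet X j = det (of fun k i => X (Fin.succ i) (j.succAbove k)) := by
  rw [← det_transpose]
  unfold minorDet
  congr 1

/-- A fixed prime rarely divides a combination of two first-row minors. -/
lemma matMeasure_real_dvd_le {M s : ℕ} (hs : 4 * s ≤ M + 1) {j₁ j₂ : Fin (M + 2)} (hj : j₁ ≠ j₂)
    {τ₁ : ℤ} (τ₂ : ℤ) (hτ : ((τ₁ : ℤ) : ZMod p) ≠ 0) :
    (matMeasure (M + 2)).real {X | (p : ℤ) ∣ τ₁ * minorDet X j₁ + τ₂ * minorDet X j₂} ≤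
      4 / p + (M + 1) * rankError (M + 1) s := by
  obtain ⟨i, rfl⟩ := Fin.exists_succAbove_eq hj.symm
  obtain ⟨ε, hε⟩ := exists_minor_comb_eq_det j₁ i
  refine le_trans (le_trans (measureReal_mono ?_) (matMeasure_real_columns_mem _).le)
    (mass_not_linearIndependent_comb_le hs j₁ i ((τ₂ * ε : ℤ) : ZMod p) hτ)
  intro X hX
  simp only [Set.mem_ofPred_eq, minorDet_eq_det_columns] at hX ⊢
  rw [hε (fun j i => X (Fin.succ i) j)] at hX
  replace hX := (ZMod.intCast_zmod_eq_zero_iff_dvd _ p).2 hX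
  rw [Int.cast_det] at hX
  intro hind
  set B : Fin (M + 1) → Fin (M + 1) → ZMod p := i.insertNth _ _ with hB
  have hunit := (Matrix.linearIndependent_rows_iff_isUnit (A := of B)).1 hind
  rw [Matrix.isUnit_iff_isUnit_det, isUnit_iff_ne_zero] at hunit
  refine hunit (Eq.trans ?_ hX)
  rw [hB]
  congr 1
  ext k l
  refine Fin.succAboveCases i ?_ (fun k => ?_) k <;> simp

end Reduction

section Divisors

/-- Small primes are counted, and large primes are few. -/
lemma log_card_divisors_le {m P : ℕ} {b : ℝ} (hb : Real.log m ≤ b) (hP : 2 ≤ P) :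
    Real.log m.divisors.card ≤
      Real.log (1 + 2 * b) * ((Finset.range (P + 1)).filter fun p => p.Prime ∧ p ∣ m).card +
        b / Real.log P := by
  have hP2 : (2 : ℝ) ≤ P := by exact_mod_cast hP
  have hlogP : 0 < Real.log P := Real.log_pos (by linarith)
  have hb0 : 0 ≤ b := (Real.log_natCast_nonneg m).trans hb
  have hl0 : 0 ≤ Real.log (1 + 2 * b) := Real.log_nonneg (by linarith)
  rcases eq_or_ne m 0 with rfl | hm
  · simp only [Nat.divisors_zero, Finset.card_empty, Nat.cast_zero, Real.log_zero]
    positivity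
  have hv : ∀ p ∈ m.primeFactors, (m.factorization p : ℝ) * Real.log p ≤ b := by
    intro p hp
    have h1 : p ^ m.factorization p ≤ m := Nat.ordProj_le p hm
    have h2 : (0 : ℝ) < p := by exact_mod_cast (Nat.prime_of_mem_primeFactors hp).pos
    rw [← Real.log_pow]
    exact (Real.log_le_log (by positivity) (by exact_mod_cast h1)).trans hb
  have hlog2 : (1 : ℝ) / 2 ≤ Real.log 2 := by linarith [Real.log_two_gt_d9]
  have hsum : ∑ p ∈ m.primeFactors, (m.factorization p : ℝ) * Real.log p ≤ b := by
    have := Real.log_nat_eq_sum_factorization m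
    rw [Finsupp.sum, Nat.support_factorization] at this
    rwa [← this]
  rw [Nat.card_divisors hm, Nat.cast_prod,
    Real.log_prod fun p _ => by positivity,
    ← Finset.sum_filter_add_sum_filter_not m.primeFactors (fun p => p ≤ P)]
  refine add_le_add ?_ ?_
  · calc _ ≤ (m.primeFactors.filter fun p => p ≤ P).card • Real.log (1 + 2 * b) := by
          refine Finset.sum_le_card_nsmul _ _ _ fun p hp => ?_
          obtain ⟨hp, -⟩ := Finset.mem_filter.1 hp
          have h1 := hv p hp
          have h2 : Real.log 2 ≤ Real.log p := Real.log_le_log (by norm_num)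
            (by exact_mod_cast (Nat.prime_of_mem_primeFactors hp).two_le)
          have h3 : (0 : ℝ) ≤ m.factorization p := Nat.cast_nonneg _
          refine Real.log_le_log (by positivity) ?_
          push_cast
          nlinarith
      _ ≤ _ := by
          rw [nsmul_eq_mul, mul_comm]
          refine mul_le_mul_of_nonneg_left ?_ hl0
          refine Nat.cast_le.2 (Finset.card_le_card fun p hp => ?_)
          simp only [Finset.mem_filter, Nat.mem_primeFactors, Finset.mem_range] at hp ⊢
          exact ⟨by omega, hp.1.1, hp.1.2.1⟩
  · rw [le_div_iff₀ hlogP, Finset.sum_mul]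
    refine le_trans ?_ hsum
    refine (Finset.sum_le_sum fun p hp => ?_).trans
      (Finset.sum_le_sum_of_subset_of_nonneg (Finset.filter_subset (fun p => ¬ p ≤ P) _)
        fun p _ _ => mul_nonneg (Nat.cast_nonneg _) (Real.log_natCast_nonneg p))
    have hpP : P ≤ p := (not_le.1 (Finset.mem_filter.1 hp).2).le
    have h1 : Real.log P ≤ Real.log p :=
      Real.log_le_log (by linarith) (by exact_mod_cast hpP)
    have h2 : Real.log ((m.factorization p + 1 : ℕ) : ℝ) ≤ m.factorization p := by
      refine (Real.log_le_sub_one_of_pos (by positivity)).trans ?_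
      push_cast
      linarith
    exact mul_le_mul h2 h1 hlogP.le (Nat.cast_nonneg _)

lemma card_primes_dyadic_le (k : ℕ) :
    k * ((Finset.Ioc (2 ^ k) (2 ^ (k + 1))).filter Nat.Prime).card ≤ 2 ^ (k + 2) := by
  have h1 : (2 ^ k) ^ ((Finset.Ioc (2 ^ k) (2 ^ (k + 1))).filter Nat.Prime).card ≤
      primorial (2 ^ (k + 1)) := by
    rw [← Finset.prod_const]
    refine (Finset.prod_le_prod' fun p hp => ?_).trans
      (Finset.prod_le_prod_of_subset_of_one_le' (t := (Finset.range (2 ^ (k + 1) + 1)).filter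
        Nat.Prime) (fun p hp => ?_) fun p hp _ => (Finset.mem_filter.1 hp).2.one_lt.le)
    · exact (Finset.mem_Ioc.1 (Finset.mem_filter.1 hp).1).1.le
    · simp only [Finset.mem_filter, Finset.mem_Ioc, Finset.mem_range] at hp ⊢
      exact ⟨by omega, hp.2⟩
  have h2 := h1.trans (primorial_le_four_pow _)
  rw [← pow_mul, show (4 : ℕ) = 2 ^ 2 by norm_num, ← pow_mul] at h2
  have h3 := (Nat.pow_le_pow_iff_right (by norm_num)).1 h2
  refine h3.trans_eq ?_
  ring

/-- A weak form of the second theorem of Mertens. -/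
lemma sum_inv_primes_le (q : ℕ) :
    ∑ p ∈ (Finset.range (2 ^ (q + 1) + 1)).filter Nat.Prime, (1 / p : ℝ) ≤
      1 + 4 * (harmonic q : ℝ) := by
  induction q with
  | zero =>
    have : (Finset.range (2 ^ (0 + 1) + 1)).filter Nat.Prime = {2} := by decide
    rw [this]
    norm_num
  | succ q ih =>
    have hsplit : (Finset.range (2 ^ (q + 1 + 1) + 1)).filter Nat.Prime =
        (Finset.range (2 ^ (q + 1) + 1)).filter Nat.Prime ∪
          (Finset.Ioc (2 ^ (q + 1)) (2 ^ (q + 1 + 1))).filter Nat.Prime := by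
      have := Nat.pow_le_pow_right (n := 2) (by norm_num) (Nat.le_succ (q + 1))
      rw [← Finset.filter_union]
      congr 1
      ext p
      simp only [Finset.mem_union, Finset.mem_range, Finset.mem_Ioc]
      omega
    have hdisj : Disjoint ((Finset.range (2 ^ (q + 1) + 1)).filter Nat.Prime)
        ((Finset.Ioc (2 ^ (q + 1)) (2 ^ (q + 1 + 1))).filter Nat.Prime) := by
      rw [Finset.disjoint_left]
      intro p h1 h2
      simp only [Finset.mem_filter, Finset.mem_range, Finset.mem_Ioc] at h1 h2
      omega
    have hblock : ∑ p ∈ (Finset.Ioc (2 ^ (q + 1)) (2 ^ (q + 1 + 1))).filter Nat.Prime,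
        (1 / p : ℝ) ≤ 4 / (q + 1) := by
      refine (Finset.sum_le_card_nsmul _ _ (1 / 2 ^ (q + 1)) fun p hp => ?_).trans ?_
      · have h1 := (Finset.mem_Ioc.1 (Finset.mem_filter.1 hp).1).1.le
        exact one_div_le_one_div_of_le (by positivity) (by exact_mod_cast h1)
      · have h1 : ((q + 1 : ℕ) : ℝ) *
            ((Finset.Ioc (2 ^ (q + 1)) (2 ^ (q + 1 + 1))).filter Nat.Prime).card ≤
              2 ^ (q + 1 + 2) := by
          exact_mod_cast card_primes_dyadic_le (q + 1)
        rw [nsmul_eq_mul, mul_one_div, div_le_div_iff₀ (by positivity) (by positivity)]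
        push_cast at h1
        rw [pow_add 2 (q + 1) 2] at h1
        linarith
    rw [hsplit, Finset.sum_union hdisj, harmonic_succ]
    push_cast
    rw [← one_div, mul_add, mul_one_div]
    linarith

end Divisors

section Expectation

lemma ae_entryMeasure_abs_le : ∀ᵐ x ∂entryMeasure, |x| ≤ 1 := by
  simp [entryMeasure, ae_add_measure_iff, ae_dirac_eq]

lemma ae_matMeasure_abs_le (n : ℕ) : ∀ᵐ X ∂matMeasure n, ∀ i j, |X i j| ≤ 1 := by
  have h : ∀ᵐ v ∂vecMeasure n, ∀ j, |v j| ≤ 1 := by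
    rw [ae_all_iff]
    intro j
    exact (Measure.quasiMeasurePreserving_eval (fun _ => entryMeasure) j).ae
      ae_entryMeasure_abs_le
  rw [ae_all_iff]
  intro i
  exact (Measure.quasiMeasurePreserving_eval (fun _ => vecMeasure n) i).ae h

lemma abs_minorDet_le {n : ℕ} {X : Fin n → Fin n → ℤ} (hX : ∀ i j, |X i j| ≤ 1) (j : Fin n) :
    |minorDet X j| ≤ ((n - 1).factorial : ℤ) := by
  have := Matrix.det_le (A := (Matrix.of X).submatrix (delFirstRow n) (skipCol n j))
    (abv := AbsoluteValue.abs) (x := (1 : ℤ)) (fun i k => hX _ _)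
  simpa [minorDet] using this

lemma log_natAbs_comb_le {n : ℕ} (hn : 2 ≤ n) {X : Fin n → Fin n → ℤ}
    (hX : ∀ i j, |X i j| ≤ 1) (j₁ j₂ : Fin n) {τ₁ τ₂ : ℤ} (h₁ : |τ₁| ≤ 2) (h₂ : |τ₂| ≤ 2) :
    Real.log (τ₁ * minorDet X j₁ + τ₂ * minorDet X j₂).natAbs ≤ 2 * n * Real.log n := by
  obtain ⟨M, rfl⟩ : ∃ M, n = M + 2 := ⟨n - 2, by omega⟩
  set D := τ₁ * minorDet X j₁ + τ₂ * minorDet X j₂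
  have h3 : |D| ≤ 4 * ((M + 1).factorial : ℤ) := by
    have e1 := abs_minorDet_le hX j₁
    have e2 := abs_minorDet_le hX j₂
    have f1 : |τ₁ * minorDet X j₁| ≤ 2 * ((M + 1).factorial : ℤ) := by
      rw [abs_mul]
      exact mul_le_mul h₁ e1 (abs_nonneg _) (by norm_num)
    have f2 : |τ₂ * minorDet X j₂| ≤ 2 * ((M + 1).factorial : ℤ) := by
      rw [abs_mul]
      exact mul_le_mul h₂ e2 (abs_nonneg _) (by norm_num)
    have := abs_add_le (τ₁ * minorDet X j₁) (τ₂ * minorDet X j₂)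
    linarith
  have h4 : D.natAbs ≤ (M + 2) ^ (2 * (M + 2)) := by
    have h5 : D.natAbs ≤ 4 * (M + 1).factorial := by
      zify
      exact h3
    have h6 : (M + 1).factorial ≤ (M + 2) ^ (M + 1) :=
      (Nat.factorial_le_pow _).trans (Nat.pow_le_pow_left (by omega) _)
    calc D.natAbs ≤ 4 * (M + 1).factorial := h5
      _ ≤ (M + 2) ^ 2 * (M + 2) ^ (M + 1) := Nat.mul_le_mul (by nlinarith) h6
      _ = (M + 2) ^ (M + 3) := by ring
      _ ≤ _ := Nat.pow_le_pow_right (by omega) (by omega)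
  rcases eq_or_ne D.natAbs 0 with h0 | h0
  · rw [h0, Nat.cast_zero, Real.log_zero]
    exact mul_nonneg (by positivity) (Real.log_natCast_nonneg _)
  · calc Real.log D.natAbs ≤ Real.log (((M + 2 : ℕ) : ℝ) ^ (2 * (M + 2))) :=
          Real.log_le_log (by positivity) (by exact_mod_cast h4)
      _ = _ := by
          rw [Real.log_pow]
          push_cast
          ring

lemma integral_log_divisors_le_trivial {n : ℕ} (hn : 2 ≤ n) (j₁ j₂ : Fin n) {τ₁ τ₂ : ℤ}
    (h₁ : |τ₁| ≤ 2) (h₂ : |τ₂| ≤ 2) :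
    (∫ X, Real.log
      ((τ₁ * minorDet X j₁ + τ₂ * minorDet X j₂).natAbs.divisors.card : ℝ)
      ∂(matMeasure n)) ≤ 2 * n * Real.log n := by
  refine (integral_mono_of_nonneg (Filter.Eventually.of_forall fun X =>
    Real.log_natCast_nonneg _) (integrable_const (2 * n * Real.log n)) ?_).trans_eq (by simp)
  filter_upwards [ae_matMeasure_abs_le n] with X hX
  refine le_trans ?_ (log_natAbs_comb_le hn hX j₁ j₂ h₁ h₂)
  set m := (τ₁ * minorDet X j₁ + τ₂ * minorDet X j₂).natAbs
  rcases eq_or_ne m 0 with h0 | h0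
  · simp [h0]
  · exact Real.log_le_log (by exact_mod_cast Finset.card_pos.2 (Nat.nonempty_divisors.2 h0))
      (by exact_mod_cast Nat.card_divisors_le_self m)

lemma integral_log_divisors_le_sum {n : ℕ} (hn : 2 ≤ n) (j₁ j₂ : Fin n) {τ₁ τ₂ : ℤ}
    (h₁ : |τ₁| ≤ 2) (h₂ : |τ₂| ≤ 2) {P : ℕ} (hP : 2 ≤ P) :
    (∫ X, Real.log
      ((τ₁ * minorDet X j₁ + τ₂ * minorDet X j₂).natAbs.divisors.card : ℝ)
      ∂(matMeasure n)) ≤ Real.log (1 + 4 * n * Real.log n) *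
        (∑ p ∈ (Finset.range (P + 1)).filter Nat.Prime, (matMeasure n).real
          {X | (p : ℤ) ∣ τ₁ * minorDet X j₁ + τ₂ * minorDet X j₂}) +
        2 * n * Real.log n / Real.log P := by
  set S : ℕ → Set (Fin n → Fin n → ℤ) := fun p =>
    {X | (p : ℤ) ∣ τ₁ * minorDet X j₁ + τ₂ * minorDet X j₂} with hS
  have hint : ∀ p, Integrable ((S p).indicator fun _ => (1 : ℝ)) (matMeasure n) := fun p =>
    (integrable_const 1).indicator (MeasurableSet.of_discrete)
  have hsum := integrable_finsetSum ((Finset.range (P + 1)).filter Nat.Prime) fun p _ => hint p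
  refine (integral_mono_of_nonneg (Filter.Eventually.of_forall fun X =>
    Real.log_natCast_nonneg _) (((hsum.const_mul (Real.log (1 + 4 * n * Real.log n)))).add
      (integrable_const (2 * n * Real.log n / Real.log P))) ?_).trans_eq ?_
  · filter_upwards [ae_matMeasure_abs_le n] with X hX
    have hb := log_natAbs_comb_le hn hX j₁ j₂ h₁ h₂
    refine (log_card_divisors_le hb hP).trans_eq ?_
    simp only [Pi.add_apply, Set.indicator_apply, Finset.sum_boole, Finset.filter_filter]
    congr 3
    · ring
    · congr 1
      ext p
      simp [hS, Int.natCast_dvd]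
  · rw [integral_add' (hsum.const_mul _) (integrable_const _), integral_const_mul,
      integral_finsetSum _ fun p _ => hint p]
    congr 1
    · congr 1
      refine Finset.sum_congr rfl fun p _ => ?_
      rw [integral_indicator MeasurableSet.of_discrete]
      simp [hS]
    · simp

lemma integral_log_divisors_le {M s q : ℕ} (hs : 4 * s ≤ M + 1) {j₁ j₂ : Fin (M + 2)}
    (hj : j₁ ≠ j₂) {τ₁ τ₂ : ℤ} (h₀ : τ₁ ≠ 0) (h₁ : |τ₁| ≤ 2) (h₂ : |τ₂| ≤ 2) :
    (∫ X, Real.log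
      ((τ₁ * minorDet X j₁ + τ₂ * minorDet X j₂).natAbs.divisors.card : ℝ)
      ∂(matMeasure (M + 2))) ≤
      Real.log (1 + 4 * ((M + 2 : ℕ) : ℝ) * Real.log (M + 2 : ℕ)) *
        (1 + 4 * (1 + 4 * (harmonic q : ℝ)) +
          2 ^ (q + 1) * (((M : ℝ) + 1) * rankError (M + 1) s)) +
        2 * ((M + 2 : ℕ) : ℝ) * Real.log (M + 2 : ℕ) / ((q + 1) * Real.log 2) := by
  have h2 : 2 ≤ 2 ^ (q + 1) := by
    rw [pow_succ]
    have := Nat.one_le_two_pow (n := q)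
    omega
  have hl : 0 ≤ Real.log (M + 2 : ℕ) := Real.log_natCast_nonneg _
  refine (integral_log_divisors_le_sum (by omega) j₁ j₂ h₁ h₂ h2).trans ?_
  refine add_le_add (mul_le_mul_of_nonneg_left ?_ (Real.log_nonneg ?_)) (le_of_eq ?_)
  · set E := ((M : ℝ) + 1) * rankError (M + 1) s with hE
    have hE0 : 0 ≤ E := mul_nonneg (by positivity) (rankError_nonneg _ _)
    set F := (Finset.range (2 ^ (q + 1) + 1)).filter Nat.Prime with hF
    have hp : ∀ p ∈ F, (matMeasure (M + 2)).real
        {X | (p : ℤ) ∣ τ₁ * minorDet X j₁ + τ₂ * minorDet X j₂} ≤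
          (if p = 2 then 1 else 0) + (4 * (1 / p) + E) := by
      intro p hp
      have hpp := (Finset.mem_filter.1 hp).2
      split_ifs with h
      · have h3 : (0 : ℝ) ≤ 4 * (1 / p) + E := by positivity
        linarith [measureReal_le_one (μ := matMeasure (M + 2))
          (s := {X | (p : ℤ) ∣ τ₁ * minorDet X j₁ + τ₂ * minorDet X j₂})]
      · have := Fact.mk hpp
        rw [zero_add, mul_one_div]
        refine matMeasure_real_dvd_le hs hj τ₂ fun h0 => ?_
        rw [ZMod.intCast_zmod_eq_zero_iff_dvd] at h0
        have h3 := Int.le_of_dvd (abs_pos.2 h₀) ((dvd_abs _ _).2 h0)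
        have h4 := hpp.two_le
        omega
    refine (Finset.sum_le_sum hp).trans ?_
    rw [Finset.sum_add_distrib, Finset.sum_add_distrib, ← Finset.mul_sum, Finset.sum_const,
      nsmul_eq_mul, Finset.sum_ite_eq']
    have hcard : (F.card : ℝ) ≤ 2 ^ (q + 1) := by
      have : F.card ≤ (Finset.Ioc 0 (2 ^ (q + 1))).card := by
        refine Finset.card_le_card fun p hp => ?_
        simp only [hF, Finset.mem_filter, Finset.mem_range, Finset.mem_Ioc] at hp ⊢
        exact ⟨hp.2.pos, by omega⟩
      rw [Nat.card_Ioc] at this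
      exact_mod_cast this
    have h3 := sum_inv_primes_le q
    have h4 := mul_le_mul_of_nonneg_right hcard hE0
    have h5 : (if 2 ∈ F then (1 : ℝ) else 0) ≤ 1 := by split_ifs <;> norm_num
    linarith
  · have : 0 ≤ 4 * ((M + 2 : ℕ) : ℝ) * Real.log (M + 2 : ℕ) := by positivity
    linarith
  · push_cast
    rw [Real.log_pow]
    push_cast
    ring

end Expectation

section Numerics

lemma two_pow_mul_rankError_le {N l q : ℕ} (hN : N + 1 < 2 ^ (l + 1)) (hq : l + 3 ≤ q)
    (hK : 262160 * (l + 3) * q ≤ N) :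
    2 ^ (q + 1) * ((N : ℝ) * rankError N (65536 * q)) ≤ 6 := by
  have hN4 : 4 * (N : ℝ) ≤ 2 ^ (l + 3) := by
    have : 4 * N ≤ 2 ^ (l + 3) := by
      rw [pow_add] at hN ⊢
      omega
    exact_mod_cast this
  have hN0 : (0 : ℝ) ≤ N := Nat.cast_nonneg N
  have hN1 : (N : ℝ) ≤ 2 ^ (l + 3) := by linarith
  have hmul : q ≤ (l + 3) * q := Nat.le_mul_of_pos_left _ (by omega)
  have hmul' : l + 3 ≤ (l + 3) * q := Nat.le_mul_of_pos_right _ (by omega)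
  have h1 : 2 ^ q * ((N : ℝ) * ((4 * N) ^ (65536 * q) * (5 / 8) ^ (N / 2))) ≤ 1 := by
    have h58 : (5 / 8 : ℝ) ^ (N / 2) ≤ (1 / 2) ^ (N / 4) := by
      calc (5 / 8 : ℝ) ^ (N / 2) ≤ (5 / 8) ^ (2 * (N / 4)) :=
            pow_le_pow_of_le_one (by norm_num) (by norm_num) (by omega)
        _ = ((5 / 8) ^ 2) ^ (N / 4) := pow_mul _ _ _
        _ ≤ _ := pow_le_pow_left₀ (by norm_num) (by norm_num) _
    have hexp : q + ((l + 3) + (l + 3) * (65536 * q)) ≤ N / 4 := by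
      rw [Nat.le_div_iff_mul_le (by norm_num)]
      nlinarith
    calc 2 ^ q * ((N : ℝ) * ((4 * N) ^ (65536 * q) * (5 / 8) ^ (N / 2)))
        ≤ 2 ^ q * (2 ^ (l + 3) * ((2 ^ (l + 3)) ^ (65536 * q) * (1 / 2) ^ (N / 4))) := by
          gcongr
      _ = 2 ^ (q + ((l + 3) + (l + 3) * (65536 * q))) * (1 / 2) ^ (N / 4) := by
          rw [pow_add 2 q, pow_add 2 (l + 3), pow_mul 2 (l + 3)]
          simp only [mul_assoc]
      _ ≤ 2 ^ (N / 4) * (1 / 2) ^ (N / 4) := by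
          gcongr
          norm_num
      _ = 1 := by rw [← mul_pow]; norm_num
  have h2 : 2 ^ q * ((N : ℝ) * (2 ^ N * (1 / 32) ^ (N / 2))) ≤ 1 := by
    calc 2 ^ q * ((N : ℝ) * (2 ^ N * (1 / 32) ^ (N / 2)))
        ≤ 2 ^ q * (2 ^ (l + 3) * (2 ^ N * (1 / 32) ^ (N / 2))) := by gcongr
      _ = 2 ^ (q + ((l + 3) + N)) * (1 / 32) ^ (N / 2) := by
          rw [pow_add 2 q, pow_add 2 (l + 3)]
          ring
      _ ≤ 2 ^ (5 * (N / 2)) * (1 / 32) ^ (N / 2) := by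
          gcongr
          · norm_num
          · rw [mul_assoc] at hK
            omega
      _ = 1 := by rw [pow_mul, ← mul_pow]; norm_num
  have h3 : 2 ^ q * ((N : ℝ) * (4 * Real.exp (-((65536 * q : ℕ) / 4 ^ 7 / 2)))) ≤ 1 := by
    have he : Real.exp (-((65536 * q : ℕ) / 4 ^ 7 / 2)) ≤ (1 / 2) ^ (2 * q) := by
      have h5 : (-((65536 * q : ℕ) / 4 ^ 7 / 2) : ℝ) = ((2 * q : ℕ) : ℝ) * (-1) := by
        push_cast
        ring
      rw [h5, Real.exp_nat_mul]
      refine pow_le_pow_left₀ (Real.exp_pos _).le ?_ _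
      rw [Real.exp_neg, one_div]
      exact inv_anti₀ (by norm_num) (by linarith [Real.add_one_le_exp 1])
    calc 2 ^ q * ((N : ℝ) * (4 * Real.exp (-((65536 * q : ℕ) / 4 ^ 7 / 2))))
        = 2 ^ q * ((4 * N) * Real.exp (-((65536 * q : ℕ) / 4 ^ 7 / 2))) := by ring
      _ ≤ 2 ^ q * (2 ^ q * (1 / 2) ^ (2 * q)) := by
          gcongr
          exact hN4.trans (pow_le_pow_right₀ (by norm_num) hq)
      _ = 1 := by rw [← mul_assoc, ← mul_pow, pow_mul, ← mul_pow]; norm_num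
  rw [rankError]
  calc _ = 2 * (2 ^ q * ((N : ℝ) * ((4 * N) ^ (65536 * q) * (5 / 8) ^ (N / 2))) +
        2 ^ q * ((N : ℝ) * (2 ^ N * (1 / 32) ^ (N / 2))) +
        2 ^ q * ((N : ℝ) * (4 * Real.exp (-((65536 * q : ℕ) / 4 ^ 7 / 2))))) := by ring
    _ ≤ 6 := by linarith

lemma half_le_log_natCast {n : ℕ} (hn : 2 ≤ n) : 1 / 2 ≤ Real.log n := by
  have : Real.log 2 ≤ Real.log n := Real.log_le_log (by norm_num) (by exact_mod_cast hn)
  linarith [Real.log_two_gt_d9]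

lemma natLog_add_three_le {n : ℕ} (hn : 2 ≤ n) : (Nat.log 2 n : ℝ) + 3 ≤ 8 * Real.log n := by
  have h1 : ((2 : ℝ) ^ Nat.log 2 n) ≤ n := by
    exact_mod_cast Nat.pow_log_le_self 2 (by omega)
  have h2 := Real.log_le_log (by positivity) h1
  rw [Real.log_pow] at h2
  have h3 : (0 : ℝ) ≤ Nat.log 2 n := Nat.cast_nonneg _
  nlinarith [Real.log_two_gt_d9, half_le_log_natCast hn]

lemma log_one_add_le {n : ℕ} (hn : 2 ≤ n) :
    Real.log (1 + 4 * n * Real.log n) ≤ 5 * Real.log n := by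
  have h2 : (2 : ℝ) ≤ n := by exact_mod_cast hn
  have h3 : Real.log n ≤ n := Real.log_le_self (by positivity)
  have h4 : 1 + 4 * (n : ℝ) * Real.log n ≤ (n : ℝ) ^ 5 := by
    have h5 : 4 * (n : ℝ) * Real.log n ≤ 4 * n * n := by gcongr
    have h6 : (2 : ℝ) ^ 3 ≤ n ^ 3 := pow_le_pow_left₀ (by norm_num) h2 3
    nlinarith [mul_le_mul_of_nonneg_left h6 (sq_nonneg (n : ℝ))]
  refine (Real.log_le_log (by positivity) h4).trans_eq ?_
  rw [Real.log_pow]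
  norm_num

lemma exists_natLog_sq_le :
    ∃ n₀ : ℕ, ∀ M : ℕ, n₀ ≤ M + 2 → 262160 * (Nat.log 2 (M + 2) + 3) ^ 2 ≤ M + 1 := by
  have h := ((Real.isLittleO_pow_log_id_atTop (n := 2)).bound
    (show (0 : ℝ) < 1 / (128 * 262160) by norm_num))
  obtain ⟨n₀, hn₀⟩ := Filter.eventually_atTop.1 (tendsto_natCast_atTop_atTop.eventually h)
  refine ⟨n₀, fun M hM => ?_⟩
  have h1 := hn₀ _ hM
  rw [Real.norm_of_nonneg (by positivity), id, Real.norm_of_nonneg (by positivity)] at h1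
  have h2 := natLog_add_three_le (n := M + 2) (by omega)
  have h3 := pow_le_pow_left₀ (by positivity) h2 2
  have h4 : (262160 * (Nat.log 2 (M + 2) + 3) ^ 2 : ℝ) ≤ M + 1 := by
    push_cast at h1 h3
    have : (0 : ℝ) ≤ M := Nat.cast_nonneg M
    linarith
  exact_mod_cast h4

end Numerics

/-- Let `d₁, d₂` be determinants of two different first-row minors of a random
`{0, ±1}` matrix, and `τ₁, τ₂ ∈ {±1, ±2}`.  Let `Y` be the number of positive
divisors of `τ₁ d₁ + τ₂ d₂` (with `Y = 1` if this is zero; note that the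
integrand `log (card (divisors 0)) = log 0 = 0 = log 1` matches this
convention).  Then `𝔼[log Y] ≤ C (log n)²` for an absolute constant `C > 0`. -/
theorem expected_log_divisors_minor_comb_le :
    ∃ C : ℝ, 0 < C ∧ ∀ n : ℕ, 2 ≤ n → ∀ j₁ j₂ : Fin n, j₁ < j₂ →
      ∀ τ₁ τ₂ : ℤ, τ₁ ∈ ({1, -1, 2, -2} : Set ℤ) → τ₂ ∈ ({1, -1, 2, -2} : Set ℤ) →
      (∫ M, Real.log
          ((τ₁ * minorDet M j₁ + τ₂ * minorDet M j₂).natAbs.divisors.card : ℝ)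
          ∂(matMeasure n)) ≤ C * Real.log n ^ 2 := by
  have habs : ∀ τ ∈ ({1, -1, 2, -2} : Set ℤ), τ ≠ 0 ∧ |τ| ≤ 2 := by
    rintro τ (rfl | rfl | rfl | rfl) <;> norm_num
  obtain ⟨n₀, hn₀⟩ := exists_natLog_sq_le
  refine ⟨350 + 64 * 262160 + 4 * n₀, by positivity, ?_⟩
  intro n hn j₁ j₂ hj τ₁ τ₂ hτ₁ hτ₂
  obtain ⟨h₀, h₁⟩ := habs τ₁ hτ₁
  obtain ⟨-, h₂⟩ := habs τ₂ hτ₂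
  have hL := half_le_log_natCast hn
  rcases lt_or_ge n n₀ with hlt | hge
  · refine (integral_log_divisors_le_trivial hn j₁ j₂ h₁ h₂).trans ?_
    have h3 : (n : ℝ) ≤ n₀ := by exact_mod_cast hlt.le
    have h4 : (0 : ℝ) ≤ n₀ := Nat.cast_nonneg _
    have h5 : (n : ℝ) * Real.log n ≤ n₀ * Real.log n := by gcongr
    have h6 : (n₀ : ℝ) * Real.log n ≤ n₀ * (2 * Real.log n ^ 2) := by
      gcongr
      nlinarith
    nlinarith [sq_nonneg (Real.log n)]
  · obtain ⟨M, rfl⟩ : ∃ M, n = M + 2 := ⟨n - 2, by omega⟩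
    have hlog := natLog_add_three_le hn
    have hsq := hn₀ M hge
    set L := Real.log (M + 2 : ℕ)
    set l := Nat.log 2 (M + 2) with hl
    set q := (M + 1) / (262160 * (l + 3)) with hq
    have hql : l + 3 ≤ q := by
      rw [hq, Nat.le_div_iff_mul_le (by positivity)]
      linarith
    have hK : 262160 * (l + 3) * q ≤ M + 1 :=
      Nat.mul_div_le (M + 1) (262160 * (l + 3))
    have hK' : M + 1 < 262160 * (l + 3) * (q + 1) :=
      Nat.lt_mul_div_succ (M + 1) (by positivity)
    have hN : M + 1 + 1 < 2 ^ (l + 1) := Nat.lt_pow_succ_log_self (by norm_num) _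
    have hqM : 4 * (65536 * q) ≤ M + 1 := by
      have : q ≤ (l + 3) * q := Nat.le_mul_of_pos_left _ (by omega)
      rw [mul_assoc] at hK
      linarith
    have herr := two_pow_mul_rankError_le hN hql hK
    push_cast at herr
    refine (integral_log_divisors_le (q := q) hqM hj.ne h₀ h₁ h₂).trans ?_
    have hharm : (harmonic q : ℝ) ≤ 1 + L := by
      refine (harmonic_le_one_add_log q).trans ?_
      have h3 : (0 : ℝ) < q := by exact_mod_cast (show 0 < q by omega)
      exact add_le_add_right (Real.log_le_log h3 (by exact_mod_cast (show q ≤ M + 2 by omega))) 1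
    have hlog1 := log_one_add_le hn
    have hsecond : 2 * ((M + 2 : ℕ) : ℝ) * L / ((q + 1) * Real.log 2) ≤
        64 * 262160 * L ^ 2 := by
      have h3 : ((M + 2 : ℕ) : ℝ) ≤ 2 * (262160 * (l + 3) * (q + 1)) := by
        have : M + 2 ≤ 2 * (262160 * (l + 3) * (q + 1)) := by omega
        exact_mod_cast this
      have hlog2 : (1 : ℝ) / 2 ≤ Real.log 2 := by linarith [Real.log_two_gt_d9]
      rw [div_le_iff₀ (by positivity)]
      calc 2 * ((M + 2 : ℕ) : ℝ) * L
          ≤ 2 * (2 * (262160 * (8 * L) * (q + 1))) * L := by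
            gcongr
            exact h3.trans (by gcongr)
        _ = 64 * 262160 * L ^ 2 * ((q + 1) * (1 / 2)) := by ring
        _ ≤ _ := by gcongr
    have hfirst := mul_le_mul hlog1 (show 1 + 4 * (1 + 4 * (harmonic q : ℝ)) +
        2 ^ (q + 1) * (((M : ℝ) + 1) * rankError (M + 1) (65536 * q)) ≤ 70 * L by linarith)
      (by have := rankError_nonneg (M + 1) (65536 * q)
          have : (0 : ℝ) ≤ harmonic q := by
            exact_mod_cast (show 0 < harmonic q from harmonic_pos (by omega)).le
          positivity) (by linarith)
    have h4 : (0 : ℝ) ≤ 4 * n₀ * L ^ 2 := by positivity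
    linarith
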